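/- Let n ≥ 3, Λ > 1, p ≥ 2, δ > 0, r₀, L > 0, 0 < δ′ < δ, and a ∈ ℝ. Let g : ℝⁿ → Sym⁺(n) be a continuous metric of class W^{1,2}_loc such that: (i) Λ⁻¹ I ≤ g(x) ≤ Λ I for all x ∈ ℝⁿ; (ii) ∫_{B(x₀,r)} |∇g|^p dx ≤ L r^{n−p+δ} for every x₀ ∈ ℝⁿ and every 0 < r < r₀; (iii) there exist a compact set Σ ⊂ ℝⁿ and constants C, b > 0 with Leb(Σ(ε)) ≤ C ε^{2−δ′/p} for all 0 < ε ≤ b, such that g is smooth on ℝⁿ∖Σ and its classical scalar curvature satisfies R_g ≥ a pointwise on ℝⁿ∖Σ. Then for every smooth compactly supported u : ℝⁿ → [0,∞), the distributional scalar curvature pairing satisfies ⟨⟨R_g, u⟩⟩ ≥ a ∫_{ℝⁿ} u √(det g) dx. -/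

import Mathlib

open MeasureTheory Metric

/-- The `i`-th partial derivative of a real-valued function on ℝⁿ
(Euclidean background). -/
noncomputable def pd {n : ℕ} (i : Fin n) (f : EuclideanSpace ℝ (Fin n) → ℝ)
    (x : EuclideanSpace ℝ (Fin n)) : ℝ :=
  fderiv ℝ f x (EuclideanSpace.single i 1)

/-- The Christoffel symbols Ψ^k_{ij} of a metric `g` in Euclidean coordinates,
built from classical partial derivatives. -/
noncomputable def christoffel {n : ℕ}
    (g : EuclideanSpace ℝ (Fin n) → Matrix (Fin n) (Fin n) ℝ)
    (x : EuclideanSpace ℝ (Fin n)) (k i j : Fin n) : ℝ :=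
  (1/2) * ∑ l, (g x)⁻¹ k l *
    (pd i (fun z => g z j l) x + pd j (fun z => g z i l) x - pd l (fun z => g z i j) x)

/-- The classical scalar curvature of a metric `g` in Euclidean coordinates,
R_g = g^{ij}( ∂_k Ψ^k_{ij} − ∂_i Ψ^k_{kj} + Ψ^k_{kℓ} Ψ^ℓ_{ij} − Ψ^k_{iℓ} Ψ^ℓ_{kj} ). -/
noncomputable def scalarCurv {n : ℕ}
    (g : EuclideanSpace ℝ (Fin n) → Matrix (Fin n) (Fin n) ℝ)
    (x : EuclideanSpace ℝ (Fin n)) : ℝ :=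
  ∑ i, ∑ j, (g x)⁻¹ i j *
    ((∑ k, pd k (fun z => christoffel g z k i j) x)
      - (∑ k, pd i (fun z => christoffel g z k k j) x)
      + ∑ k, ∑ l, (christoffel g x k k l * christoffel g x l i j
          - christoffel g x k i l * christoffel g x l k j))


lemma aux_cutoff {n : ℕ} (S : Set (EuclideanSpace ℝ (Fin n))) (ε : ℝ) (hε : 0 < ε) :
    ∃ χ : EuclideanSpace ℝ (Fin n) → ℝ, ContDiff ℝ (⊤ : ℕ∞) χ ∧ (∀ x, 0 ≤ χ x) ∧ (∀ x, χ x ≤ 1) ∧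
      (∀ x ∈ thickening ε S, χ x = 1) ∧ (∀ x ∉ thickening (4 * ε) S, χ x = 0) ∧
      (∀ x, ‖fderiv ℝ χ x‖ ≤ ε⁻¹) ∧ (∀ x ∉ thickening (4 * ε) S, fderiv ℝ χ x = 0) := by
  let φ : ContDiffBump (0 : EuclideanSpace ℝ (Fin n)) := ⟨ε / 2, ε, by linarith, by linarith⟩
  have hrout : φ.rOut = ε := rfl
  let f : EuclideanSpace ℝ (Fin n) → ℝ := fun x => (thickenedIndicator hε (thickening (2 * ε) S) x : ℝ)
  have hflip : LipschitzWith ε.toNNReal⁻¹ f := by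
    have := lipschitzWith_thickenedIndicator hε (thickening (2 * ε) S)
    intro x y
    exact this x y
  have hfc : Continuous f := hflip.continuous
  have hf0 : ∀ x, 0 ≤ f x := fun x => NNReal.coe_nonneg _
  have hf1 : ∀ x, f x ≤ 1 := fun x => by
    have := thickenedIndicator_le_one hε (thickening (2 * ε) S) x
    exact_mod_cast this
  let χ : EuclideanSpace ℝ (Fin n) → ℝ :=
    MeasureTheory.convolution (φ.normed volume) f (ContinuousLinearMap.lsmul ℝ ℝ) volume
  have hχ : ∀ x, χ x = ∫ t, φ.normed volume t * f (x - t) := fun x => rfl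
  have hint : ∀ x, Integrable (fun t => φ.normed volume t * f (x - t)) := by
    intro x
    apply Continuous.integrable_of_hasCompactSupport
    · exact (φ.continuous_normed).mul (hfc.comp (by fun_prop))
    · exact φ.hasCompactSupport_normed.mul_right
  have hsm : ContDiff ℝ (⊤ : ℕ∞) χ :=
    φ.hasCompactSupport_normed.contDiff_convolution_left _ φ.contDiff_normed
      hfc.locallyIntegrable
  have h0 : ∀ x, 0 ≤ χ x := fun x => by
    rw [hχ]
    exact integral_nonneg fun t => mul_nonneg (φ.nonneg_normed t) (hf0 _)
  have h1 : ∀ x, χ x ≤ 1 := fun x => by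
    rw [hχ, ← φ.integral_normed (μ := volume)]
    refine integral_mono (hint x) φ.integrable_normed fun t => ?_
    have := φ.nonneg_normed (μ := volume) t
    nlinarith [hf1 (x - t)]
  have h4 : ∀ x ∉ thickening (4 * ε) S, χ x = 0 := by
    intro x hx
    have hz : ∀ y ∈ ball x φ.rOut, f y = 0 := by
      intro y hy
      have : y ∉ thickening ε (thickening (2 * ε) S) := by
        intro hy2
        apply hx
        have h3 := thickening_thickening_subset ε (2 * ε) S hy2
        rw [mem_thickening_iff] at h3 ⊢
        obtain ⟨z, hz, hd⟩ := h3
        refine ⟨z, hz, ?_⟩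
        have := dist_triangle x y z
        rw [mem_ball, dist_comm, hrout] at hy
        linarith
      have := thickenedIndicator_zero hε (thickening (2 * ε) S) this
      simp only [f, this]; rfl
    have := φ.normed_convolution_eq_right (μ := volume) (g := f) (x₀ := x) (by
      intro y hy
      rw [hz y hy, hz x (mem_ball_self φ.rOut_pos)])
    rw [hz x (mem_ball_self φ.rOut_pos)] at this
    exact this
  refine ⟨χ, hsm, h0, h1, ?_, h4, ?_, ?_⟩
  · intro x hx
    have hz : ∀ y ∈ ball x φ.rOut, f y = 1 := by
      intro y hy
      have : y ∈ thickening (2 * ε) S := by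
        rw [mem_thickening_iff] at hx ⊢
        obtain ⟨z, hz, hd⟩ := hx
        refine ⟨z, hz, ?_⟩
        have := dist_triangle y x z
        rw [mem_ball, hrout] at hy
        linarith
      have := thickenedIndicator_one hε (thickening (2 * ε) S) this
      simp only [f, this]; rfl
    have := φ.normed_convolution_eq_right (μ := volume) (g := f) (x₀ := x) (by
      intro y hy
      rw [hz y hy, hz x (mem_ball_self φ.rOut_pos)])
    rw [hz x (mem_ball_self φ.rOut_pos)] at this
    exact this
  · intro x
    have hl : LipschitzWith ε.toNNReal⁻¹ χ := by
      apply LipschitzWith.of_dist_le_mul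
      intro x y
      rw [Real.dist_eq, hχ, hχ, ← integral_sub (hint x) (hint y), ← Real.norm_eq_abs]
      have : (ε.toNNReal⁻¹ : NNReal) * dist x y
          = ∫ t, φ.normed volume t * ((ε.toNNReal⁻¹ : NNReal) * dist x y) := by
        rw [integral_mul_const, φ.integral_normed, one_mul]
      rw [this]
      refine norm_integral_le_of_norm_le (φ.integrable_normed.mul_const _) (.of_forall fun t => ?_)
      rw [← mul_sub, norm_mul, Real.norm_of_nonneg (φ.nonneg_normed t)]
      refine mul_le_mul_of_nonneg_left ?_ (φ.nonneg_normed t)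
      have := hflip.dist_le_mul (x - t) (y - t)
      rwa [dist_sub_right, Real.dist_eq] at this
    have := norm_fderiv_le_of_lipschitz ℝ hl (x₀ := x)
    simpa [hε.le] using this
  · intro x hx
    apply IsLocalMin.fderiv_eq_zero
    apply Filter.Eventually.of_forall
    intro y
    rw [h4 x hx]; exact h0 y

/-- averaging lemma -/
lemma aux_average {n : ℕ} (f : EuclideanSpace ℝ (Fin n) → ENNReal) (hf : Measurable f)
    (T : Set (EuclideanSpace ℝ (Fin n))) (hT : MeasurableSet T) (r : ℝ) (M : ENNReal)
    (hM : ∀ y, ∫⁻ x in ball y r, f x ≤ M) :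
    volume (ball (0 : EuclideanSpace ℝ (Fin n)) r) * ∫⁻ x in T, f x
      ≤ volume (thickening r T) * M := by
  have hms : MeasurableSet {q : EuclideanSpace ℝ (Fin n) × EuclideanSpace ℝ (Fin n) |
      dist q.1 q.2 < r} := (isOpen_lt continuous_dist continuous_const).measurableSet
  let k : EuclideanSpace ℝ (Fin n) → EuclideanSpace ℝ (Fin n) → ENNReal := fun x y =>
    {q : EuclideanSpace ℝ (Fin n) × EuclideanSpace ℝ (Fin n) |
      dist q.1 q.2 < r}.indicator (fun q => f q.1) (x, y)
  have hk : Measurable (Function.uncurry k) := (hf.comp measurable_fst).indicator hms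
  have hkx : ∀ x y, k x y = (ball x r).indicator (fun _ => f x) y := by
    intro x y
    simp only [k, Set.indicator, Set.mem_ofPred_eq, mem_ball, dist_comm]
  have hky : ∀ x y, k x y = (ball y r).indicator f x := by
    intro x y
    simp only [k, Set.indicator, Set.mem_ofPred_eq, mem_ball]
  calc volume (ball (0 : EuclideanSpace ℝ (Fin n)) r) * ∫⁻ x in T, f x
      = ∫⁻ x in T, volume (ball (0 : EuclideanSpace ℝ (Fin n)) r) * f x :=
        (lintegral_const_mul _ hf).symm
    _ = ∫⁻ x in T, ∫⁻ y in thickening r T, k x y := by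
        refine setLIntegral_congr_fun hT fun x hx => ?_
        simp only [hkx]
        rw [lintegral_indicator measurableSet_ball, setLIntegral_const,
          Measure.restrict_apply measurableSet_ball,
          Set.inter_eq_left.mpr (ball_subset_thickening hx r),
          Measure.addHaar_ball_center volume x r, mul_comm]
    _ = ∫⁻ y in thickening r T, ∫⁻ x in T, k x y := by
        exact lintegral_lintegral_swap hk.aemeasurable
    _ ≤ ∫⁻ y in thickening r T, M := by
        refine lintegral_mono fun y => ?_
        refine le_trans (setLIntegral_le_lintegral _ _) ?_
        simp only [hky]
        rw [lintegral_indicator measurableSet_ball]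
        exact hM y
    _ = volume (thickening r T) * M := by
        rw [setLIntegral_const, mul_comm]

lemma aux_morrey {n : ℕ} (p δ r₀ L : ℝ) (hL : 0 < L)
    (G : EuclideanSpace ℝ (Fin n) → ℝ) (hG : Measurable G)
    (hMorrey : ∀ (x₀ : EuclideanSpace ℝ (Fin n)) (r : ℝ), 0 < r → r < r₀ →
      (∫⁻ x in Metric.ball x₀ r, ENNReal.ofReal ((G x) ^ p)) ≤
        ENNReal.ofReal (L * r ^ ((n : ℝ) - p + δ))) :
    ∃ c : ℝ, 0 < c ∧ ∀ (T : Set (EuclideanSpace ℝ (Fin n))) (_ : MeasurableSet T) (ε : ℝ),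
      0 < ε → ε < r₀ → ∫⁻ x in T, ENNReal.ofReal ((G x) ^ p) ≤
        volume (thickening ε T) * ENNReal.ofReal (c * ε ^ (δ - p)) := by
  obtain ⟨w, hw, hww⟩ : ∃ w : ℝ, 0 < w ∧
      volume (ball (0 : EuclideanSpace ℝ (Fin n)) 1) = ENNReal.ofReal w := by
    refine ⟨(volume (ball (0 : EuclideanSpace ℝ (Fin n)) 1)).toReal, ?_, ?_⟩
    · exact ENNReal.toReal_pos (measure_ball_pos _ _ one_pos).ne' measure_ball_lt_top.ne
    · rw [ENNReal.ofReal_toReal measure_ball_lt_top.ne]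
  refine ⟨L / w, by positivity, fun T hT ε hε hεr => ?_⟩
  have h := aux_average (fun x => ENNReal.ofReal ((G x) ^ p)) (by fun_prop) T hT ε _
    (fun y => hMorrey y ε hε hεr)
  rw [Measure.addHaar_ball_of_pos volume _ hε, finrank_euclideanSpace_fin, hww,
    ← ENNReal.ofReal_mul (by positivity)] at h
  have hpos : 0 < ε ^ n * w := by positivity
  rw [← ENNReal.mul_le_mul_iff_right (a := ENNReal.ofReal (ε ^ n * w))
    (ENNReal.ofReal_pos.mpr hpos).ne' ENNReal.ofReal_ne_top]
  refine h.trans (le_of_eq ?_)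
  rw [mul_left_comm, ← ENNReal.ofReal_mul hpos.le]
  congr 2
  have : ε ^ ((n : ℝ) - p + δ) = ε ^ n * ε ^ (δ - p) := by
    rw [← Real.rpow_natCast, ← Real.rpow_add hε]; congr 1; ring
  rw [this]
  field_simp

lemma aux_young (p t G : ℝ) (hp : 2 ≤ p) (ht : 0 < t) (hG : 0 ≤ G) :
    G ≤ t ^ (p - 1) * G ^ p + t⁻¹ := by
  by_cases h : t * G ≤ 1
  · have h1 : G ≤ t⁻¹ := by
      rw [← one_div, le_div_iff₀ ht]; linarith
    have : 0 ≤ t ^ (p - 1) * G ^ p := by positivity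
    linarith
  · push Not at h
    have hGp : 0 < G := by
      rcases hG.eq_or_lt with h0 | h0
      · rw [← h0] at h; norm_num at h
      · exact h0
    have h1 : 1 ≤ (t * G) ^ (p - 1) := Real.one_le_rpow h.le (by linarith)
    have h2 : t ^ (p - 1) * G ^ p = (t * G) ^ (p - 1) * G := by
      rw [Real.mul_rpow ht.le hG, mul_assoc]
      congr 1
      rw [← Real.rpow_add_one hGp.ne']; congr 1; ring
    rw [h2]
    have : 0 < t⁻¹ := by positivity
    nlinarith

lemma aux_decay {n : ℕ} (p δ δ' r₀ L : ℝ) (hp : 2 ≤ p) (hδ'δ : δ' < δ) (hr₀ : 0 < r₀) (hL : 0 < L)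
    (G : EuclideanSpace ℝ (Fin n) → ℝ) (hG : Measurable G) (hG0 : ∀ x, 0 ≤ G x)
    (hMorrey : ∀ (x₀ : EuclideanSpace ℝ (Fin n)) (r : ℝ), 0 < r → r < r₀ →
      (∫⁻ x in Metric.ball x₀ r, ENNReal.ofReal ((G x) ^ p)) ≤
        ENNReal.ofReal (L * r ^ ((n : ℝ) - p + δ)))
    (S : Set (EuclideanSpace ℝ (Fin n))) (C b : ℝ) (hC : 0 < C) (hb : 0 < b)
    (hvol : ∀ ε : ℝ, 0 < ε → ε ≤ b →
      volume (Metric.thickening ε S) ≤ ENNReal.ofReal (C * ε ^ (2 - δ'/p))) :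
    ∃ c e ε₀ : ℝ, 0 < c ∧ 0 < e ∧ 0 < ε₀ ∧ ∀ ε, 0 < ε → ε < ε₀ →
      ∫⁻ x in thickening (4 * ε) S, ENNReal.ofReal (ε⁻¹ * G x) ≤ ENNReal.ofReal (c * ε ^ e) := by
  obtain ⟨c, hc, hcT⟩ := aux_morrey p δ r₀ L hL G hG hMorrey
  set q := 2 - δ' / p with hq
  set D := C * 5 ^ q with hD
  have hDpos : 0 < D := by positivity
  have hp0 : 0 < p := by linarith
  refine ⟨D * c + D, (δ - δ') / p, min r₀ (b / 5), by positivity, div_pos (by linarith) hp0,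
    by positivity, fun ε hε hε0 => ?_⟩
  have hε1 : ε < r₀ := hε0.trans_le (min_le_left _ _)
  have hε2 : 5 * ε ≤ b := by have := hε0.trans_le (min_le_right _ _); linarith
  set T := thickening (4 * ε) S with hTdef
  have hv5 : volume (thickening (5 * ε) S) ≤ ENNReal.ofReal (D * ε ^ q) := by
    refine (hvol _ (by positivity) hε2).trans (le_of_eq ?_)
    rw [Real.mul_rpow (by norm_num) hε.le, hD, mul_assoc]
  have hvT : volume T ≤ ENNReal.ofReal (D * ε ^ q) :=
    (measure_mono (thickening_mono (by linarith) S)).trans hv5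
  have hvTT : volume (thickening ε T) ≤ ENNReal.ofReal (D * ε ^ q) := by
    refine (measure_mono ?_).trans hv5
    refine (thickening_thickening_subset _ _ _).trans (thickening_mono (by linarith) S)
  have h1 := (hcT T isOpen_thickening.measurableSet ε hε hε1).trans
    (mul_le_mul_left hvTT _)
  rw [← ENNReal.ofReal_mul (by positivity)] at h1
  set t := ε ^ (1 - δ' / p - (δ - δ') / p) with ht
  have htpos : 0 < t := by positivity
  calc ∫⁻ x in T, ENNReal.ofReal (ε⁻¹ * G x)
      ≤ ∫⁻ x in T, (ENNReal.ofReal (ε⁻¹ * t ^ (p - 1)) * ENNReal.ofReal (G x ^ p)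
          + ENNReal.ofReal (ε⁻¹ * t⁻¹)) := by
        refine lintegral_mono fun x => ?_
        have := hG0 x
        rw [← ENNReal.ofReal_mul (by positivity), ← ENNReal.ofReal_add (by positivity) (by positivity)]
        apply ENNReal.ofReal_le_ofReal
        have := mul_le_mul_of_nonneg_left (aux_young p t (G x) hp htpos this)
          (inv_nonneg.mpr hε.le)
        linarith
    _ = ENNReal.ofReal (ε⁻¹ * t ^ (p - 1)) * (∫⁻ x in T, ENNReal.ofReal (G x ^ p))
          + ENNReal.ofReal (ε⁻¹ * t⁻¹) * volume T := by
        rw [lintegral_add_right _ measurable_const, lintegral_const_mul _ (by fun_prop),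
          setLIntegral_const]
    _ ≤ ENNReal.ofReal (ε⁻¹ * t ^ (p - 1)) * ENNReal.ofReal (D * ε ^ q * (c * ε ^ (δ - p)))
          + ENNReal.ofReal (ε⁻¹ * t⁻¹) * ENNReal.ofReal (D * ε ^ q) := by
        gcongr
    _ = ENNReal.ofReal ((D * c + D) * ε ^ ((δ - δ') / p)) := by
        rw [← ENNReal.ofReal_mul (by positivity), ← ENNReal.ofReal_mul (by positivity),
          ← ENNReal.ofReal_add (by positivity) (by positivity)]
        congr 1
        have e1 : ε⁻¹ * t ^ (p - 1) * ε ^ q * ε ^ (δ - p) = ε ^ ((δ - δ') / p) := by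
          rw [ht, ← Real.rpow_mul hε.le, ← Real.rpow_neg_one, ← Real.rpow_add hε,
            ← Real.rpow_add hε, ← Real.rpow_add hε]
          congr 1
          rw [hq]; field_simp; ring
        have e2 : ε⁻¹ * t⁻¹ * ε ^ q = ε ^ ((δ - δ') / p) := by
          rw [ht, ← Real.rpow_neg hε.le, ← Real.rpow_neg_one, ← Real.rpow_add hε,
            ← Real.rpow_add hε]
          congr 1
          rw [hq]; field_simp; ring
        rw [add_mul, ← e1]
        nth_rewrite 2 [e1]
        rw [← e2]
        ring

lemma aux_zero {n : ℕ} (p δ r₀ L : ℝ) (hp : 2 ≤ p) (hδ : p < δ) (hr₀ : 0 < r₀) (hL : 0 < L)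
    (G : EuclideanSpace ℝ (Fin n) → ℝ) (hG : Measurable G) (hG0 : ∀ x, 0 ≤ G x)
    (hMorrey : ∀ (x₀ : EuclideanSpace ℝ (Fin n)) (r : ℝ), 0 < r → r < r₀ →
      (∫⁻ x in Metric.ball x₀ r, ENNReal.ofReal ((G x) ^ p)) ≤
        ENNReal.ofReal (L * r ^ ((n : ℝ) - p + δ))) :
    ∀ᵐ x, G x = 0 := by
  obtain ⟨c, hc, hcT⟩ := aux_morrey p δ r₀ L hL G hG hMorrey
  have hball : ∀ R : ℕ, ∫⁻ x in ball (0 : EuclideanSpace ℝ (Fin n)) R,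
      ENNReal.ofReal ((G x) ^ p) = 0 := by
    intro R
    have hlim : Filter.Tendsto (fun ε : ℝ => volume (ball (0 : EuclideanSpace ℝ (Fin n)) (1 + R)) *
        ENNReal.ofReal (c * ε ^ (δ - p))) (nhdsWithin 0 (Set.Ioi 0)) (nhds 0) := by
      have h1 : Filter.Tendsto (fun ε : ℝ => c * ε ^ (δ - p)) (nhdsWithin 0 (Set.Ioi 0))
          (nhds (c * 0 ^ (δ - p))) := by
        refine Filter.Tendsto.mono_left ?_ nhdsWithin_le_nhds
        exact ((Real.continuousAt_rpow_const 0 (δ - p) (Or.inr (by linarith))).tendsto).const_mul c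
      rw [Real.zero_rpow (by linarith), mul_zero] at h1
      have h2 := ENNReal.Tendsto.const_mul (a := volume (ball (0 : EuclideanSpace ℝ (Fin n)) (1 + R)))
        (ENNReal.tendsto_ofReal h1) (Or.inr measure_ball_lt_top.ne)
      simpa using h2
    refine le_antisymm (ge_of_tendsto hlim ?_) zero_le
    have : ∀ᶠ ε : ℝ in nhdsWithin 0 (Set.Ioi 0), ε ∈ Set.Ioo 0 (min r₀ 1) :=
      Ioo_mem_nhdsGT (by positivity)
    filter_upwards [this] with ε hε
    refine (hcT _ measurableSet_ball ε hε.1 (hε.2.trans_le (min_le_left _ _))).trans ?_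
    gcongr
    intro x hx
    rw [mem_thickening_iff] at hx
    obtain ⟨z, hz, hd⟩ := hx
    rw [mem_ball] at hz ⊢
    have := hε.2.trans_le (min_le_right _ _)
    have := dist_triangle x z 0
    linarith
  have h0 : ∫⁻ x, ENNReal.ofReal ((G x) ^ p) = 0 := by
    rw [← setLIntegral_univ, ← iUnion_ball_nat (0 : EuclideanSpace ℝ (Fin n))]
    refine le_antisymm ((lintegral_iUnion_le _ _).trans ?_) zero_le
    simp [hball]
  rw [lintegral_eq_zero_iff (by fun_prop)] at h0
  filter_upwards [h0] with x hx
  have h1 : G x ^ p ≤ 0 := by simpa using hx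
  by_contra h
  have : 0 < G x := lt_of_le_of_ne (hG0 x) (Ne.symm h)
  have : 0 < G x ^ p := by positivity
  linarith

noncomputable def aPsi {n : ℕ} (A : Matrix (Fin n) (Fin n) ℝ) (D : Fin n → Fin n → Fin n → ℝ)
    (k i j : Fin n) : ℝ :=
  (1/2) * ∑ l, A⁻¹ k l * (D i j l + D j i l - D l i j)

noncomputable def aDinv {n : ℕ} (A : Matrix (Fin n) (Fin n) ℝ) (D : Fin n → Fin n → Fin n → ℝ)
    (k i j : Fin n) : ℝ :=
  -∑ q, ∑ s, A⁻¹ i q * A⁻¹ j s * D k q s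

noncomputable def aV {n : ℕ} (A : Matrix (Fin n) (Fin n) ℝ) (D : Fin n → Fin n → Fin n → ℝ)
    (k : Fin n) : ℝ :=
  (∑ i, ∑ j, A⁻¹ i j * aPsi A D k i j) - ∑ i, ∑ j, A⁻¹ i k * aPsi A D j j i

noncomputable def aF {n : ℕ} (A : Matrix (Fin n) (Fin n) ℝ) (D : Fin n → Fin n → Fin n → ℝ) : ℝ :=
  -(∑ k, ∑ i, ∑ j, aDinv A D k i j * aPsi A D k i j)
    + (∑ k, ∑ i, aDinv A D k i k * ∑ j, aPsi A D j j i)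
    + ∑ i, ∑ j, A⁻¹ i j *
        ∑ k, ∑ l, (aPsi A D k k l * aPsi A D l i j - aPsi A D k j l * aPsi A D l i k)

noncomputable def aT {n : ℕ} (A : Matrix (Fin n) (Fin n) ℝ) (D : Fin n → Fin n → Fin n → ℝ)
    (k : Fin n) : ℝ := (1/2) * Real.sqrt A.det * ∑ i, ∑ j, A⁻¹ i j * D k i j

noncomputable def aI {n : ℕ} (A : Matrix (Fin n) (Fin n) ℝ) (D : Fin n → Fin n → Fin n → ℝ)
    (du : Fin n → ℝ) (u : ℝ) : ℝ :=
  -(∑ k, aV A D k * (du k * Real.sqrt A.det + u * aT A D k)) + aF A D * u * Real.sqrt A.det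

section pdrules
variable {n : ℕ} {x : EuclideanSpace ℝ (Fin n)}

lemma pd_mul' (k : Fin n) {f h : EuclideanSpace ℝ (Fin n) → ℝ}
    (hf : DifferentiableAt ℝ f x) (hh : DifferentiableAt ℝ h x) :
    pd k (fun z => f z * h z) x = pd k f x * h x + f x * pd k h x := by
  unfold pd
  rw [fderiv_fun_mul hf hh]
  simp; ring

lemma pd_sub' (k : Fin n) {f h : EuclideanSpace ℝ (Fin n) → ℝ}
    (hf : DifferentiableAt ℝ f x) (hh : DifferentiableAt ℝ h x) :
    pd k (fun z => f z - h z) x = pd k f x - pd k h x := by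
  unfold pd
  rw [fderiv_fun_sub hf hh]
  simp

lemma pd_add' (k : Fin n) {f h : EuclideanSpace ℝ (Fin n) → ℝ}
    (hf : DifferentiableAt ℝ f x) (hh : DifferentiableAt ℝ h x) :
    pd k (fun z => f z + h z) x = pd k f x + pd k h x := by
  unfold pd
  rw [fderiv_fun_add hf hh]
  simp

lemma pd_sum' (k : Fin n) {ι : Type*} (s : Finset ι) {f : ι → EuclideanSpace ℝ (Fin n) → ℝ}
    (hf : ∀ i ∈ s, DifferentiableAt ℝ (f i) x) :
    pd k (fun z => ∑ i ∈ s, f i z) x = ∑ i ∈ s, pd k (f i) x := by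
  unfold pd
  rw [fderiv_fun_sum hf]
  simp

lemma pd_congr' (k : Fin n) {f h : EuclideanSpace ℝ (Fin n) → ℝ}
    (hf : f =ᶠ[nhds x] h) : pd k f x = pd k h x := by
  unfold pd
  rw [hf.fderiv_eq]

lemma contDiffAt_pd (k : Fin n) {f : EuclideanSpace ℝ (Fin n) → ℝ}
    (hf : ContDiffAt ℝ (⊤ : ℕ∞) f x) : ContDiffAt ℝ (⊤ : ℕ∞) (pd k f) x := by
  have h : ContDiffAt ℝ (⊤ : ℕ∞) (fderiv ℝ f) x := hf.fderiv_right (m := (⊤ : ℕ∞)) (by simp)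
  exact h.clm_apply contDiffAt_const

end pdrules

section geom
variable {n : ℕ} {g : EuclideanSpace ℝ (Fin n) → Matrix (Fin n) (Fin n) ℝ}
  {x : EuclideanSpace ℝ (Fin n)}

lemma contDiffAt_det {m : ℕ∞} (hg : ∀ i j, ContDiffAt ℝ m (fun z => g z i j) x) :
    ContDiffAt ℝ m (fun z => (g z).det) x := by
  simp only [Matrix.det_apply]
  refine ContDiffAt.sum fun σ _ => ?_
  refine ContDiffAt.const_smul _ ?_
  exact contDiffAt_prod fun i _ => hg _ _

lemma contDiffAt_matinv {m : ℕ∞} (hg : ∀ i j, ContDiffAt ℝ m (fun z => g z i j) x)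
    (hdet : (g x).det ≠ 0) (i j : Fin n) :
    ContDiffAt ℝ m (fun z => (g z)⁻¹ i j) x := by
  simp only [Matrix.inv_def, Matrix.smul_apply, Ring.inverse_eq_inv', smul_eq_mul]
  refine ((contDiffAt_det hg).inv hdet).mul ?_
  simp only [Matrix.adjugate_apply]
  refine contDiffAt_det (g := fun z => (g z).updateRow j (Pi.single i 1)) ?_
  intro a b
  by_cases h : a = j
  · subst h; simp only [Matrix.updateRow_self]; exact contDiffAt_const
  · simp only [Matrix.updateRow_ne h]; exact hg a b

lemma contDiffAt_sqrtdet {m : ℕ∞} (hg : ∀ i j, ContDiffAt ℝ m (fun z => g z i j) x)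
    (hdet : (g x).det ≠ 0) :
    ContDiffAt ℝ m (fun z => Real.sqrt (g z).det) x :=
  (contDiffAt_det hg).sqrt hdet

lemma pd_det (k : Fin n) (hg : ∀ i j, DifferentiableAt ℝ (fun z => g z i j) x)
    (hdet : (g x).det ≠ 0) :
    pd k (fun z => (g z).det) x
      = (g x).det * ∑ i, ∑ j, (g x)⁻¹ i j * pd k (fun z => g z j i) x := by
  have h1 : ∀ i j, (g x)⁻¹ i j = (g x).det⁻¹ * (g x).adjugate i j := by
    intro i j
    simp [Matrix.inv_def, Ring.inverse_eq_inv']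
  have h2 : ∀ i, ∑ j, (g x).det * ((g x)⁻¹ i j * pd k (fun z => g z j i) x)
      = ((g x).updateCol i (fun j => pd k (fun z => g z j i) x)).det := by
    intro i
    rw [← Matrix.cramer_apply, Matrix.cramer_eq_adjugate_mulVec]
    simp only [Matrix.mulVec, dotProduct, h1]
    refine Finset.sum_congr rfl fun j _ => ?_
    field_simp
  have hpd : ∀ σ : Equiv.Perm (Fin n), DifferentiableAt ℝ (fun z => ∏ i, g z (σ i) i) x :=
    fun σ => (HasFDerivAt.finsetProd (fun i _ => (hg (σ i) i).hasFDerivAt)).differentiableAt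
  simp only [Finset.mul_sum, h2]
  simp only [Matrix.det_apply']
  rw [pd_sum' k _ (fun σ _ => (hpd σ).const_mul _), Finset.sum_comm]
  refine Finset.sum_congr rfl fun σ _ => ?_
  rw [← Finset.mul_sum]
  unfold pd
  rw [fderiv_const_mul (hpd σ)]
  rw [fderiv_finsetProd (fun i _ => hg (σ i) i)]
  simp only [smul_apply, smul_eq_mul, _root_.sum_apply]
  congr 1
  refine Finset.sum_congr rfl fun i _ => ?_
  rw [← Finset.prod_erase_mul _ _ (Finset.mem_univ i)]
  simp only [Matrix.updateCol_self]
  congr 1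
  refine Finset.prod_congr rfl fun j hj => ?_
  rw [Matrix.updateCol_ne (Finset.ne_of_mem_erase hj)]

lemma pd_sqrtdet (k : Fin n) (hg : ∀ i j, DifferentiableAt ℝ (fun z => g z i j) x)
    (hd : DifferentiableAt ℝ (fun z => (g z).det) x)
    (hpos : (g x).PosDef) :
    pd k (fun z => Real.sqrt (g z).det) x = aT (g x) (fun k i j => pd k (fun z => g z i j) x) k := by
  have hdet := hpos.det_pos
  have h1 := pd_det k hg hdet.ne'
  unfold pd at *
  rw [fderiv_sqrt hd hdet.ne']
  simp only [smul_apply, smul_eq_mul]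
  rw [h1]
  unfold aT
  have hs : (g x).det = Real.sqrt (g x).det * Real.sqrt (g x).det :=
    (Real.mul_self_sqrt hdet.le).symm
  have hs0 : 0 < Real.sqrt (g x).det := Real.sqrt_pos.mpr hdet
  have hsym : ∑ i, ∑ j, (g x)⁻¹ i j * (fderiv ℝ (fun z => g z j i) x) (EuclideanSpace.single k 1)
      = ∑ i, ∑ j, (g x)⁻¹ i j * (fderiv ℝ (fun z => g z i j) x) (EuclideanSpace.single k 1) := by
    rw [Finset.sum_comm]
    refine Finset.sum_congr rfl fun i _ => Finset.sum_congr rfl fun j _ => ?_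
    have := hpos.isHermitian.inv
    have := this.apply i j
    simp only [star_trivial] at this
    rw [this]
  rw [hsym]
  nth_rewrite 2 [hs]
  field_simp

lemma pd_inv (k : Fin n) (hg : ∀ i j, DifferentiableAt ℝ (fun z => g z i j) x)
    (hi : ∀ i j, DifferentiableAt ℝ (fun z => (g z)⁻¹ i j) x)
    (hpos : ∀ z, (g z).PosDef) (i j : Fin n) :
    pd k (fun z => (g z)⁻¹ i j) x = aDinv (g x) (fun k i j => pd k (fun z => g z i j) x) k i j := by
  let P : Matrix (Fin n) (Fin n) ℝ := fun i j => pd k (fun z => (g z)⁻¹ i j) x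
  let Q : Matrix (Fin n) (Fin n) ℝ := fun i j => pd k (fun z => g z i j) x
  have hu : IsUnit (g x).det := (hpos x).det_pos.ne'.isUnit
  have hPQ : P * g x + (g x)⁻¹ * Q = 0 := by
    ext a c
    have h1 : (fun z => ∑ m, (g z)⁻¹ a m * g z m c) = fun z => (1 : Matrix (Fin n) (Fin n) ℝ) a c := by
      funext z
      rw [← Matrix.mul_apply, Matrix.nonsing_inv_mul _ (hpos z).det_pos.ne'.isUnit]
    have h2 : pd k (fun z => ∑ m, (g z)⁻¹ a m * g z m c) x = 0 := by
      rw [h1]; simp [pd]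
    rw [pd_sum' k _ (fun m _ => (hi a m).fun_mul (hg m c))] at h2
    simp only [pd_mul' k (hi a _) (hg _ c), Finset.sum_add_distrib] at h2
    rw [Matrix.add_apply, Matrix.mul_apply, Matrix.mul_apply]
    exact h2
  have hP : P = -((g x)⁻¹ * Q * (g x)⁻¹) := by
    have h3 : P * g x = -((g x)⁻¹ * Q) := eq_neg_of_add_eq_zero_left hPQ
    calc P = P * g x * (g x)⁻¹ := by rw [Matrix.mul_assoc, Matrix.mul_nonsing_inv _ hu, Matrix.mul_one]
      _ = _ := by rw [h3, Matrix.neg_mul]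
  have : P i j = _ := congrFun (congrFun hP i) j
  refine this.trans ?_
  unfold aDinv
  simp only [Matrix.neg_apply, Matrix.mul_apply, Finset.sum_mul]
  rw [Finset.sum_comm]
  congr 1
  refine Finset.sum_congr rfl fun q _ => Finset.sum_congr rfl fun s _ => ?_
  have := (hpos x).isHermitian.inv.apply s j
  simp only [star_trivial] at this
  rw [← this]
  ring

lemma christoffel_eq (k i j : Fin n) :
    christoffel g x k i j = aPsi (g x) (fun k i j => pd k (fun z => g z i j) x) k i j := rfl

lemma contDiffAt_christoffel (hg : ∀ i j, ContDiffAt ℝ (⊤ : ℕ∞) (fun z => g z i j) x)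
    (hdet : (g x).det ≠ 0) (k i j : Fin n) :
    ContDiffAt ℝ (⊤ : ℕ∞) (fun z => christoffel g z k i j) x := by
  unfold christoffel
  refine contDiffAt_const.mul (ContDiffAt.sum fun l _ => (contDiffAt_matinv hg hdet k l).mul ?_)
  exact ((contDiffAt_pd i (hg j l)).add (contDiffAt_pd j (hg i l))).sub (contDiffAt_pd l (hg i j))

lemma alg_curv (B : Fin n → Fin n → ℝ) (hB : ∀ i j, B i j = B j i)
    (dB P : Fin n → Fin n → Fin n → ℝ) (hP : ∀ k i j, P k i j = P k j i)
    (dP : Fin n → Fin n → Fin n → Fin n → ℝ) :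
    (∑ k, ((∑ i, ∑ j, (dB k i j * P k i j + B i j * dP k k i j))
      - ∑ i, ∑ j, (dB k i k * P j j i + B i k * dP k j j i)))
    + (-(∑ k, ∑ i, ∑ j, dB k i j * P k i j)
    + (∑ k, ∑ i, dB k i k * ∑ j, P j j i)
    + ∑ i, ∑ j, B i j * ∑ k, ∑ l, (P k k l * P l i j - P k j l * P l i k))
    = ∑ i, ∑ j, B i j *
    ((∑ k, dP k k i j) - (∑ k, dP i k k j)
      + ∑ k, ∑ l, (P k k l * P l i j - P k i l * P l k j)) := by
  have e1 : ∑ k, ∑ i, ∑ j, B i j * dP k k i j = ∑ i, ∑ j, B i j * ∑ k, dP k k i j := by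
    rw [Finset.sum_comm]
    refine Finset.sum_congr rfl fun i _ => ?_
    rw [Finset.sum_comm]
    simp only [Finset.mul_sum]
  have e2 : ∑ k, ∑ i, ∑ j, B i k * dP k j j i = ∑ i, ∑ j, B i j * ∑ k, dP i k k j := by
    simp only [Finset.mul_sum]
    refine Finset.sum_congr rfl fun k _ => Finset.sum_congr rfl fun i _ => ?_
    rw [hB]
  have e3 : ∑ i, ∑ j, B i j * ∑ k, ∑ l, P k j l * P l i k
      = ∑ i, ∑ j, B i j * ∑ k, ∑ l, P k i l * P l k j := by
    rw [Finset.sum_comm]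
    refine Finset.sum_congr rfl fun i _ => Finset.sum_congr rfl fun j _ => ?_
    rw [hB]
    congr 1
    refine Finset.sum_congr rfl fun k _ => Finset.sum_congr rfl fun l _ => ?_
    rw [hP l j k]
  have e4 : ∑ k, ∑ i, dB k i k * ∑ j, P j j i = ∑ k, ∑ i, ∑ j, dB k i k * P j j i := by
    simp only [Finset.mul_sum]
  simp only [Finset.sum_add_distrib, Finset.sum_sub_distrib, mul_add, mul_sub] at *
  rw [e1, e2, e3, e4]
  ring

lemma scalarCurv_eq (hg : ∀ i j, ContDiffAt ℝ (⊤ : ℕ∞) (fun z => g z i j) x)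
    (hpos : ∀ z, (g z).PosDef) :
    (∑ k, pd k (fun z => aV (g z) (fun k i j => pd k (fun z => g z i j) z) k) x)
      + aF (g x) (fun k i j => pd k (fun z => g z i j) x) = scalarCurv g x := by
  have hdet := (hpos x).det_pos.ne'
  have hgd : ∀ i j, DifferentiableAt ℝ (fun z => g z i j) x := fun i j =>
    (hg i j).differentiableAt (by simp)
  have hid : ∀ i j, DifferentiableAt ℝ (fun z => (g z)⁻¹ i j) x := fun i j =>
    (contDiffAt_matinv hg hdet i j).differentiableAt (by simp)
  have hcd : ∀ k i j, DifferentiableAt ℝ (fun z => christoffel g z k i j) x := fun k i j =>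
    (contDiffAt_christoffel hg hdet k i j).differentiableAt (by simp)
  have hV : ∀ k, pd k (fun z => aV (g z) (fun k i j => pd k (fun z => g z i j) z) k) x
      = (∑ i, ∑ j, (aDinv (g x) (fun k i j => pd k (fun z => g z i j) x) k i j * christoffel g x k i j
          + (g x)⁻¹ i j * pd k (fun z => christoffel g z k i j) x))
        - ∑ i, ∑ j, (aDinv (g x) (fun k i j => pd k (fun z => g z i j) x) k i k * christoffel g x j j i
          + (g x)⁻¹ i k * pd k (fun z => christoffel g z j j i) x) := by
    intro k
    simp only [aV, ← christoffel_eq]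
    rw [pd_sub' k (DifferentiableAt.fun_sum fun i _ => DifferentiableAt.fun_sum fun j _ =>
      (hid i j).fun_mul (hcd k i j)) (DifferentiableAt.fun_sum fun i _ => DifferentiableAt.fun_sum fun j _ =>
      (hid i k).fun_mul (hcd j j i))]
    congr 1
    · rw [pd_sum' k _ fun i _ => DifferentiableAt.fun_sum fun j _ => (hid i j).fun_mul (hcd k i j)]
      refine Finset.sum_congr rfl fun i _ => ?_
      rw [pd_sum' k _ fun j _ => (hid i j).fun_mul (hcd k i j)]
      refine Finset.sum_congr rfl fun j _ => ?_
      rw [pd_mul' k (hid i j) (hcd k i j), pd_inv k hgd hid hpos]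
    · rw [pd_sum' k _ fun i _ => DifferentiableAt.fun_sum fun j _ => (hid i k).fun_mul (hcd j j i)]
      refine Finset.sum_congr rfl fun i _ => ?_
      rw [pd_sum' k _ fun j _ => (hid i k).fun_mul (hcd j j i)]
      refine Finset.sum_congr rfl fun j _ => ?_
      rw [pd_mul' k (hid i k) (hcd j j i), pd_inv k hgd hid hpos]
  simp only [hV]
  refine (alg_curv (fun i j => (g x)⁻¹ i j) ?_
    (aDinv (g x) (fun k i j => pd k (fun z => g z i j) x)) (christoffel g x) ?_
    (fun m k i j => pd m (fun z => christoffel g z k i j) x))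
  · intro i j
    have := (hpos x).isHermitian.inv.apply j i
    simpa using this
  · intro k i j
    unfold christoffel
    congr 1
    refine Finset.sum_congr rfl fun l _ => ?_
    have : (fun z => g z i j) = fun z => g z j i := by
      funext z
      have := (hpos z).isHermitian.apply j i
      simpa using this
    rw [this]
    ring

/-- the divergence identity -/
lemma divergence_eq (hg : ∀ i j, ContDiffAt ℝ (⊤ : ℕ∞) (fun z => g z i j) x)
    (hpos : ∀ z, (g z).PosDef) (w : EuclideanSpace ℝ (Fin n) → ℝ) (hw : DifferentiableAt ℝ w x) :
    (∑ k, pd k (fun z => aV (g z) (fun k i j => pd k (fun z => g z i j) z) k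
        * (w z * Real.sqrt (g z).det)) x)
      + aI (g x) (fun k i j => pd k (fun z => g z i j) x) (fun k => pd k w x) (w x)
    = scalarCurv g x * w x * Real.sqrt (g x).det := by
  have hdet := (hpos x).det_pos.ne'
  have hgd : ∀ i j, DifferentiableAt ℝ (fun z => g z i j) x := fun i j =>
    (hg i j).differentiableAt (by simp)
  have hid : ∀ i j, DifferentiableAt ℝ (fun z => (g z)⁻¹ i j) x := fun i j =>
    (contDiffAt_matinv hg hdet i j).differentiableAt (by simp)
  have hcd : ∀ k i j, DifferentiableAt ℝ (fun z => christoffel g z k i j) x := fun k i j =>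
    (contDiffAt_christoffel hg hdet k i j).differentiableAt (by simp)
  have hVd : ∀ k, DifferentiableAt ℝ
      (fun z => aV (g z) (fun k i j => pd k (fun z => g z i j) z) k) x := by
    intro k
    simp only [aV, ← christoffel_eq]
    exact (DifferentiableAt.fun_sum fun i _ => DifferentiableAt.fun_sum fun j _ =>
      (hid i j).fun_mul (hcd k i j)).sub (DifferentiableAt.fun_sum fun i _ =>
        DifferentiableAt.fun_sum fun j _ => (hid i k).fun_mul (hcd j j i))
  have hsd := (contDiffAt_sqrtdet hg hdet).differentiableAt (by simp)
  have hdd := (contDiffAt_det hg).differentiableAt (by simp)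
  have h1 : ∀ k, pd k (fun z => aV (g z) (fun k i j => pd k (fun z => g z i j) z) k
        * (w z * Real.sqrt (g z).det)) x
      = pd k (fun z => aV (g z) (fun k i j => pd k (fun z => g z i j) z) k) x
          * (w x * Real.sqrt (g x).det)
        + aV (g x) (fun k i j => pd k (fun z => g z i j) x) k
          * (pd k w x * Real.sqrt (g x).det +
            w x * aT (g x) (fun k i j => pd k (fun z => g z i j) x) k) := by
    intro k
    rw [pd_mul' k (hVd k) (hw.fun_mul hsd), pd_mul' k hw hsd, pd_sqrtdet k hgd hdd (hpos x)]
  simp only [h1, Finset.sum_add_distrib, ← Finset.sum_mul]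
  rw [← scalarCurv_eq hg hpos]
  unfold aI
  ring

end geom

lemma pd_integral_zero {n : ℕ} (k : Fin n) (X : EuclideanSpace ℝ (Fin n) → ℝ)
    (hX : ContDiff ℝ (⊤ : ℕ∞) X) (hc : HasCompactSupport X) :
    Integrable (pd k X) ∧ ∫ x, pd k X x = 0 := by
  have hcont : Continuous (pd k X) :=
    (hX.continuous_fderiv (by simp)).clm_apply continuous_const
  have hcs : HasCompactSupport (pd k X) := hc.fderiv_apply (𝕜 := ℝ) _
  have hi : Integrable (pd k X) := hcont.integrable_of_hasCompactSupport hcs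
  refine ⟨hi, ?_⟩
  have h := integral_mul_fderiv_eq_neg_fderiv_mul_of_integrable (μ := volume)
    (f := fun _ : EuclideanSpace ℝ (Fin n) => (1 : ℝ)) (g := X) (v := EuclideanSpace.single k 1)
    (by simp) (by simp only [one_mul]; exact hi)
    (by simpa using hX.continuous.integrable_of_hasCompactSupport hc)
    (fun x _ => by fun_prop) (fun x _ => (hX.differentiable (by simp)) x)
  simpa [pd] using h

lemma aux_locInt {n : ℕ} (h : EuclideanSpace ℝ (Fin n) → ℝ) (hm : Measurable h)
    (hL2 : ∀ (x₀ : EuclideanSpace ℝ (Fin n)) (R : ℝ),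
      (∫⁻ x in Metric.ball x₀ R, ENNReal.ofReal ((h x) ^ 2)) < ⊤) :
    LocallyIntegrable h := by
  intro x
  refine ⟨ball x 1, ball_mem_nhds x one_pos, hm.aestronglyMeasurable, ?_⟩
  have h1 : ∫⁻ y in ball x 1, (ENNReal.ofReal (h y ^ 2) + 1) < ⊤ := by
    rw [lintegral_add_right _ measurable_const, setLIntegral_const, one_mul]
    exact ENNReal.add_lt_top.mpr ⟨hL2 x 1, measure_ball_lt_top⟩
  refine lt_of_le_of_lt (lintegral_mono fun y => ?_) h1
  rw [← ENNReal.ofReal_one, ← ENNReal.ofReal_add (sq_nonneg _) zero_le_one, ← ofReal_norm]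
  apply ENNReal.ofReal_le_ofReal
  rw [Real.norm_eq_abs]
  nlinarith [sq_abs (h y), sq_nonneg (|h y| - 1), abs_nonneg (h y)]

lemma aux_weak {n : ℕ} (k : Fin n) (f h : EuclideanSpace ℝ (Fin n) → ℝ)
    (U : Set (EuclideanSpace ℝ (Fin n))) (hU : IsOpen U) (hfc : Continuous f)
    (hf : ContDiffOn ℝ (⊤ : ℕ∞) f U)
    (hh : LocallyIntegrable h)
    (hweak : ∀ (φ : EuclideanSpace ℝ (Fin n) → ℝ),
      ContDiff ℝ (⊤ : ℕ∞) φ → HasCompactSupport φ →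
      (∫ x, f x * pd k φ x) = -∫ x, h x * φ x) :
    ∀ᵐ x, x ∈ U → h x = pd k f x := by
  have hpc : ContinuousOn (pd k f) U := by
    intro x hx
    exact (contDiffAt_pd k (hf.contDiffAt (hU.mem_nhds hx))).continuousAt.continuousWithinAt
  have key : ∀ᵐ x, x ∈ U → h x - pd k f x = 0 := by
    refine hU.ae_eq_zero_of_integral_contDiff_smul_eq_zero
      (f := fun x => h x - pd k f x) ?_ ?_
    · exact (hh.locallyIntegrableOn U).sub (hpc.locallyIntegrableOn hU.measurableSet)
    · intro φ hφ hφc hφU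
      have i1 : Integrable (fun x => h x * φ x) := by
        have := hh.integrable_smul_left_of_hasCompactSupport hφ.continuous hφc
        simpa [mul_comm] using this
      have hcont : Continuous (fun x => pd k f x * φ x) := by
        refine continuous_of_tsupport (fun x hx => ?_)
        have hx' : x ∈ U := hφU (tsupport_mul_subset_right hx)
        exact (hpc.continuousAt (hU.mem_nhds hx')).mul hφ.continuous.continuousAt
      have i2 : Integrable (fun x => pd k f x * φ x) :=
        hcont.integrable_of_hasCompactSupport hφc.mul_left
      have i3 : Integrable (fun x => f x * pd k φ x) := by
        refine Continuous.integrable_of_hasCompactSupport ?_ ?_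
        · exact hfc.mul ((hφ.continuous_fderiv (by simp)).clm_apply continuous_const)
        · exact HasCompactSupport.mul_left (hφc.fderiv_apply (𝕜 := ℝ) _)
      have i4 : Integrable (fun x => f x * φ x) :=
        (hfc.mul hφ.continuous).integrable_of_hasCompactSupport hφc.mul_left
      have ibp := integral_mul_fderiv_eq_neg_fderiv_mul_of_integrable (μ := volume)
        (f := f) (g := φ) (v := EuclideanSpace.single k 1) i2 i3 i4
        (fun x hx => (hf.contDiffAt (hU.mem_nhds (hφU hx))).differentiableAt (by simp))
        (fun x _ => (hφ.differentiable (by simp)) x)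
      have hw := hweak φ hφ hφc
      have : ∫ x, φ x • (h x - pd k f x) = (∫ x, h x * φ x) - ∫ x, pd k f x * φ x := by
        rw [← integral_sub i1 i2]
        congr 1; funext x; simp only [smul_eq_mul]; ring
      rw [this]
      unfold pd at *
      linarith
  filter_upwards [key] with x hx hxU
  linarith [hx hxU]

lemma aux_main_ineq {n : ℕ} (a : ℝ)
    (g : EuclideanSpace ℝ (Fin n) → Matrix (Fin n) (Fin n) ℝ)
    (hcont : ∀ i j, Continuous fun x => g x i j)
    (hpos : ∀ x, (g x).PosDef)
    (Dg : EuclideanSpace ℝ (Fin n) → Fin n → Fin n → Fin n → ℝ)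
    (S : Set (EuclideanSpace ℝ (Fin n))) (hS : IsClosed S)
    (hsm : ∀ i j, ContDiffOn ℝ (⊤ : ℕ∞) (fun x => g x i j) Sᶜ)
    (hscal : ∀ x ∉ S, a ≤ scalarCurv g x)
    (hDg : ∀ᵐ x, x ∉ S → Dg x = fun k i j => pd k (fun z => g z i j) x)
    (w : EuclideanSpace ℝ (Fin n) → ℝ) (hw : ContDiff ℝ (⊤ : ℕ∞) w) (hwc : HasCompactSupport w)
    (hw0 : ∀ x, 0 ≤ w x) (W : Set (EuclideanSpace ℝ (Fin n))) (hW : IsOpen W) (hSW : S ⊆ W)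
    (hwW : ∀ x ∈ W, w x = 0)
    (hI : Integrable fun x => aI (g x) (Dg x) (fun k => pd k w x) (w x)) :
    a * (∫ x, w x * Real.sqrt (g x).det) ≤
      ∫ x, aI (g x) (Dg x) (fun k => pd k w x) (w x) := by
  have hgS : ∀ x ∉ S, ∀ i j, ContDiffAt ℝ (⊤ : ℕ∞) (fun z => g z i j) x := fun x hx i j =>
    (hsm i j).contDiffAt (hS.isOpen_compl.mem_nhds hx)
  let X : Fin n → EuclideanSpace ℝ (Fin n) → ℝ := fun k z =>
    aV (g z) (fun k i j => pd k (fun z => g z i j) z) k * (w z * Real.sqrt (g z).det)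
  have hXW : ∀ k, ∀ x ∈ W, X k =ᶠ[nhds x] fun _ => 0 := by
    intro k x hx
    filter_upwards [hW.mem_nhds hx] with z hz
    simp [X, hwW z hz]
  have hXs : ∀ k, ContDiff ℝ (⊤ : ℕ∞) (X k) := by
    intro k
    rw [contDiff_iff_contDiffAt]
    intro x
    by_cases hx : x ∈ S
    · exact contDiffAt_const.congr_of_eventuallyEq (hXW k x (hSW hx))
    · have hdet := (hpos x).det_pos.ne'
      have hg := hgS x hx
      refine ContDiffAt.mul ?_ (hw.contDiffAt.mul (contDiffAt_sqrtdet hg hdet))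
      simp only [aV, ← christoffel_eq]
      exact (ContDiffAt.sum fun i _ => ContDiffAt.sum fun j _ =>
        (contDiffAt_matinv hg hdet i j).mul (contDiffAt_christoffel hg hdet k i j)).sub
        (ContDiffAt.sum fun i _ => ContDiffAt.sum fun j _ =>
        (contDiffAt_matinv hg hdet i k).mul (contDiffAt_christoffel hg hdet j j i))
  have hXc : ∀ k, HasCompactSupport (X k) := fun k => (hwc.mul_right).mul_left
  have hXi := fun k => pd_integral_zero k (X k) (hXs k) (hXc k)
  have hsum : ∫ x, ∑ k, pd k (X k) x = 0 := by
    rw [integral_finsetSum _ (fun k _ => (hXi k).1)]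
    simp [(hXi _).2]
  have hsumi : Integrable fun x => ∑ k, pd k (X k) x :=
    integrable_finsetSum _ fun k _ => (hXi k).1
  have hdc : Continuous fun x => Real.sqrt (g x).det := by
    refine Real.continuous_sqrt.comp ?_
    exact Continuous.matrix_det (continuous_matrix hcont)
  have hwi : Integrable fun x => w x * Real.sqrt (g x).det :=
    (hw.continuous.mul hdc).integrable_of_hasCompactSupport hwc.mul_right
  rw [← integral_const_mul]
  have : ∫ x, aI (g x) (Dg x) (fun k => pd k w x) (w x)
      = ∫ x, ((∑ k, pd k (X k) x) + aI (g x) (Dg x) (fun k => pd k w x) (w x)) := by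
    rw [integral_add hsumi hI, hsum, zero_add]
  rw [this]
  refine integral_mono_ae (hwi.const_mul a) (hsumi.add hI) ?_
  filter_upwards [hDg] with x hx
  by_cases hxS : x ∈ S
  · have hxW := hSW hxS
    have hw00 : w =ᶠ[nhds x] fun _ => 0 := by
      filter_upwards [hW.mem_nhds hxW] with z hz using hwW z hz
    have e1 : ∀ k, pd k w x = 0 := fun k => by rw [pd_congr' k hw00]; simp [pd]
    have e2 : ∀ k, pd k (X k) x = 0 := fun k => by rw [pd_congr' k (hXW k x hxW)]; simp [pd]
    simp [e1, e2, hwW x hxW, aI]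
  · rw [hx hxS]
    have := divergence_eq (hgS x hxS) hpos w ((hw.differentiable (by simp)) x)
    refine le_trans ?_ (le_of_eq this.symm)
    rw [mul_assoc]
    exact mul_le_mul_of_nonneg_right (hscal x hxS) (mul_nonneg (hw0 x) (Real.sqrt_nonneg _))

lemma abs_sum_le_card {n : ℕ} (f : Fin n → ℝ) (c : ℝ) (h : ∀ i, |f i| ≤ c) :
    |∑ i, f i| ≤ n * c := by
  refine (Finset.abs_sum_le_sum_abs _ _).trans ?_
  refine (Finset.sum_le_sum fun i _ => h i).trans ?_
  simp

lemma abs_mul_le' {a b c d : ℝ} (h1 : |a| ≤ c) (h2 : |b| ≤ d) : |a * b| ≤ c * d := by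
  rw [abs_mul]
  exact mul_le_mul h1 h2 (abs_nonneg _) ((abs_nonneg _).trans h1)

lemma aux_bounds (n : ℕ) (M : ℝ) (hM : 0 ≤ M) : ∃ c : ℝ, 0 ≤ c ∧
    ∀ (A : Matrix (Fin n) (Fin n) ℝ) (D : Fin n → Fin n → Fin n → ℝ) (N : ℝ),
      0 ≤ N → (∀ i j, |A⁻¹ i j| ≤ M) → Real.sqrt A.det ≤ M → (∀ k i j, |D k i j| ≤ N) →
      (∀ k, |aV A D k| ≤ c * N) ∧ (∀ k, |aT A D k| ≤ c * N) ∧ |aF A D| ≤ c * N ^ 2 := by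
  obtain ⟨c1, hc1, hP⟩ : ∃ c : ℝ, 0 ≤ c ∧
      ∀ (A : Matrix (Fin n) (Fin n) ℝ) (D : Fin n → Fin n → Fin n → ℝ) (N : ℝ),
      0 ≤ N → (∀ i j, |A⁻¹ i j| ≤ M) → (∀ k i j, |D k i j| ≤ N) →
      ∀ k i j, |aPsi A D k i j| ≤ c * N := by
    refine ⟨1 / 2 * (n * (M * 3)), by positivity, fun A D N hN hA hD k i j => ?_⟩
    have h1 : ∀ l, |A⁻¹ k l * (D i j l + D j i l - D l i j)| ≤ M * (3 * N) := fun l => by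
      refine abs_mul_le' (hA _ _) ?_
      have h1 := abs_le.mp (hD i j l)
      have h2 := abs_le.mp (hD j i l)
      have h3 := abs_le.mp (hD l i j)
      rw [abs_le]; constructor <;> linarith
    have h2 := abs_mul_le' (a := 1 / 2) (c := 1 / 2) (by norm_num) (abs_sum_le_card _ _ h1)
    unfold aPsi
    linarith
  obtain ⟨c2, hc2, hDi⟩ : ∃ c : ℝ, 0 ≤ c ∧
      ∀ (A : Matrix (Fin n) (Fin n) ℝ) (D : Fin n → Fin n → Fin n → ℝ) (N : ℝ),
      0 ≤ N → (∀ i j, |A⁻¹ i j| ≤ M) → (∀ k i j, |D k i j| ≤ N) →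
      ∀ k i j, |aDinv A D k i j| ≤ c * N := by
    refine ⟨n * (n * (M * M)), by positivity, fun A D N hN hA hD k i j => ?_⟩
    unfold aDinv
    rw [abs_neg]
    have := abs_sum_le_card _ _ fun q => abs_sum_le_card _ _ fun s =>
      abs_mul_le' (abs_mul_le' (hA i q) (hA j s)) (hD k q s)
    linarith
  let cV := n * (n * (M * c1)) + n * (n * (M * c1))
  let cT := 1 / 2 * M * (n * (n * M))
  let cF := n * (n * (n * (c2 * c1))) + n * (n * (c2 * (n * c1)))
    + n * (n * (M * (n * (n * (c1 * c1 + c1 * c1)))))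
  have hcV : 0 ≤ cV := by positivity
  have hcT : 0 ≤ cT := by positivity
  have hcF : 0 ≤ cF := by positivity
  refine ⟨cV + cT + cF, by positivity, fun A D N hN hA hs hD => ⟨fun k => ?_, fun k => ?_, ?_⟩⟩
  · have hPsi := hP A D N hN hA hD
    have h1 := abs_sum_le_card _ _ fun i => abs_sum_le_card _ _ fun j =>
      abs_mul_le' (hA i j) (hPsi k i j)
    have h2 := abs_sum_le_card _ _ fun i => abs_sum_le_card _ _ fun j =>
      abs_mul_le' (hA i k) (hPsi j j i)
    have h3 : |aV A D k| ≤ cV * N := by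
      unfold aV
      refine (abs_sub _ _).trans ?_
      simp only [cV]
      linarith
    have : 0 ≤ (cT + cF) * N := by positivity
    linarith
  · have h1 := abs_sum_le_card _ _ fun i => abs_sum_le_card _ _ fun j =>
      abs_mul_le' (hA i j) (hD k i j)
    have hs' : |Real.sqrt A.det| ≤ M := by rwa [abs_of_nonneg (Real.sqrt_nonneg _)]
    have h2 := abs_mul_le' (abs_mul_le' (a := 1 / 2) (c := 1 / 2) (by norm_num) hs') h1
    have h3 : |aT A D k| ≤ cT * N := by
      unfold aT
      refine h2.trans ?_
      simp only [cT]
      linarith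
    have : 0 ≤ (cV + cF) * N := by positivity
    linarith
  · have hPsi := hP A D N hN hA hD
    have hDinv := hDi A D N hN hA hD
    have h1 := abs_sum_le_card _ _ fun k => abs_sum_le_card _ _ fun i => abs_sum_le_card _ _ fun j =>
      abs_mul_le' (hDinv k i j) (hPsi k i j)
    have h2 := abs_sum_le_card _ _ fun k => abs_sum_le_card _ _ fun i =>
      abs_mul_le' (hDinv k i k) (abs_sum_le_card _ _ fun j => hPsi j j i)
    have h3 := abs_sum_le_card _ _ fun i => abs_sum_le_card _ _ fun j =>
      abs_mul_le' (hA i j) (abs_sum_le_card _ _ fun k => abs_sum_le_card _ _ fun l =>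
        (abs_sub _ _).trans (add_le_add (abs_mul_le' (hPsi k k l) (hPsi l i j))
          (abs_mul_le' (hPsi k j l) (hPsi l i k))))
    have h4 : |aF A D| ≤ cF * N ^ 2 := by
      unfold aF
      refine (abs_add_le _ _).trans ?_
      refine (add_le_add_left (abs_add_le _ _) _).trans ?_
      rw [abs_neg]
      simp only [cF]
      linarith
    have : 0 ≤ (cV + cT) * N ^ 2 := by positivity
    linarith

lemma aI_add {n : ℕ} (A : Matrix (Fin n) (Fin n) ℝ) (D : Fin n → Fin n → Fin n → ℝ)
    (du dv : Fin n → ℝ) (u v : ℝ) :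
    aI A D (fun k => du k + dv k) (u + v) = aI A D du u + aI A D dv v := by
  unfold aI
  have : ∑ k, aV A D k * ((du k + dv k) * Real.sqrt A.det + (u + v) * aT A D k)
    = (∑ k, aV A D k * (du k * Real.sqrt A.det + u * aT A D k))
      + ∑ k, aV A D k * (dv k * Real.sqrt A.det + v * aT A D k) := by
    rw [← Finset.sum_add_distrib]
    exact Finset.sum_congr rfl fun k _ => by ring
  rw [this]; ring

/-- pointwise bound for the integrand -/
lemma aI_bound {n : ℕ} (A : Matrix (Fin n) (Fin n) ℝ) (D : Fin n → Fin n → Fin n → ℝ)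
    (du : Fin n → ℝ) (u c N M m m' : ℝ) (hN : 0 ≤ N) (hc : 0 ≤ c)
    (hV : ∀ k, |aV A D k| ≤ c * N) (hT : ∀ k, |aT A D k| ≤ c * N) (hF : |aF A D| ≤ c * N ^ 2)
    (hs : Real.sqrt A.det ≤ M) (hdu : ∀ k, |du k| ≤ m') (hu : |u| ≤ m) :
    |aI A D du u| ≤ (n * c * M * m') * N + (n * c * c * m + c * m * M) * N ^ 2 := by
  have hs' : |Real.sqrt A.det| ≤ M := by rwa [abs_of_nonneg (Real.sqrt_nonneg _)]
  have h1 := abs_sum_le_card _ _ fun k => abs_mul_le' (hV k)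
    ((abs_add_le _ _).trans (add_le_add (abs_mul_le' (hdu k) hs') (abs_mul_le' hu (hT k))))
  have h2 := abs_mul_le' (abs_mul_le' hF hu) hs'
  unfold aI
  refine (abs_add_le _ _).trans ?_
  rw [abs_neg]
  linarith

noncomputable def aG {n : ℕ} (D : Fin n → Fin n → Fin n → ℝ) : ℝ :=
  Real.sqrt (∑ k, ∑ i, ∑ j, (D k i j) ^ 2)

lemma aG_nonneg {n : ℕ} (D : Fin n → Fin n → Fin n → ℝ) : 0 ≤ aG D := Real.sqrt_nonneg _

lemma aG_sq {n : ℕ} (D : Fin n → Fin n → Fin n → ℝ) :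
    aG D ^ 2 = ∑ k, ∑ i, ∑ j, (D k i j) ^ 2 :=
  Real.sq_sqrt (Finset.sum_nonneg fun _ _ => Finset.sum_nonneg fun _ _ =>
    Finset.sum_nonneg fun _ _ => sq_nonneg _)

lemma le_aG {n : ℕ} (D : Fin n → Fin n → Fin n → ℝ) (k i j : Fin n) : |D k i j| ≤ aG D := by
  refine abs_le_of_sq_le_sq ?_ (aG_nonneg D)
  rw [aG_sq]
  refine le_trans ?_ (Finset.single_le_sum (f := fun k => ∑ i, ∑ j, (D k i j) ^ 2)
    (fun _ _ => Finset.sum_nonneg fun _ _ => Finset.sum_nonneg fun _ _ => sq_nonneg _)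
    (Finset.mem_univ k))
  refine le_trans ?_ (Finset.single_le_sum (f := fun i => ∑ j, (D k i j) ^ 2)
    (fun _ _ => Finset.sum_nonneg fun _ _ => sq_nonneg _) (Finset.mem_univ i))
  exact Finset.single_le_sum (f := fun j => (D k i j) ^ 2)
    (fun _ _ => sq_nonneg _) (Finset.mem_univ j)

section final
variable {n : ℕ} {g : EuclideanSpace ℝ (Fin n) → Matrix (Fin n) (Fin n) ℝ}
  {Dg : EuclideanSpace ℝ (Fin n) → Fin n → Fin n → Fin n → ℝ}

lemma measurable_aG (hDgmeas : ∀ k i j, Measurable fun x => Dg x k i j) :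
    Measurable fun x => aG (Dg x) := by
  unfold aG
  fun_prop

lemma aG_sq_integrableOn (hDgmeas : ∀ k i j, Measurable fun x => Dg x k i j)
    (hDgL2 : ∀ (k i j : Fin n) (x₀ : EuclideanSpace ℝ (Fin n)) (R : ℝ),
      (∫⁻ x in Metric.ball x₀ R, ENNReal.ofReal ((Dg x k i j) ^ 2)) < ⊤)
    (K : Set (EuclideanSpace ℝ (Fin n))) (hK : IsCompact K) :
    IntegrableOn (fun x => aG (Dg x) ^ 2) K := by
  obtain ⟨R, hR⟩ := hK.isBounded.subset_ball 0
  refine IntegrableOn.mono_set ?_ hR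
  simp only [aG_sq]
  refine integrable_finsetSum _ fun k _ => integrable_finsetSum _ fun i _ =>
    integrable_finsetSum _ fun j _ => ?_
  refine ⟨((hDgmeas k i j).pow_const 2).aestronglyMeasurable, ?_⟩
  rw [hasFiniteIntegral_iff_ofReal (.of_forall fun x => sq_nonneg _)]
  exact hDgL2 k i j 0 R

lemma continuous_matinv (hcont : ∀ i j, Continuous fun x => g x i j)
    (hpos : ∀ x, (g x).PosDef) (i j : Fin n) : Continuous fun x => (g x)⁻¹ i j := by
  have : ContDiff ℝ ((0 : ℕ∞) : WithTop ℕ∞) fun x => (g x)⁻¹ i j := by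
    rw [contDiff_iff_contDiffAt]
    intro x
    refine contDiffAt_matinv (fun i j => ?_) (hpos x).det_pos.ne' i j
    exact (contDiff_zero.mpr (hcont i j)).contDiffAt
  exact this.continuous

lemma continuous_sqrtdet (hcont : ∀ i j, Continuous fun x => g x i j) :
    Continuous fun x => Real.sqrt (g x).det :=
  Real.continuous_sqrt.comp (Continuous.matrix_det (continuous_matrix hcont))

lemma aux_pt (hcont : ∀ i j, Continuous fun x => g x i j)
    (hpos : ∀ x, (g x).PosDef) (K : Set (EuclideanSpace ℝ (Fin n))) (hK : IsCompact K) :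
    ∃ c : ℝ, 0 ≤ c ∧ ∀ x ∈ K, ∀ (D : Fin n → Fin n → Fin n → ℝ) (du : Fin n → ℝ) (u m m' : ℝ),
      0 ≤ m → 0 ≤ m' →
      (∀ k, |du k| ≤ m') → |u| ≤ m →
      |aI (g x) D du u| ≤ c * (m' * aG D + m * aG D ^ 2) := by
  obtain ⟨M1, hM1⟩ := hK.exists_bound_of_continuousOn (continuous_sqrtdet hcont).continuousOn
  have h2 : ∀ i j, ∃ M, ∀ x ∈ K, ‖(g x)⁻¹ i j‖ ≤ M := fun i j =>
    hK.exists_bound_of_continuousOn (continuous_matinv hcont hpos i j).continuousOn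
  choose M2 hM2 using h2
  let M := |M1| + ∑ i, ∑ j, |M2 i j|
  have hM : 0 ≤ M := by positivity
  obtain ⟨c, hc, hb⟩ := aux_bounds n M hM
  refine ⟨n * c * M + (n * c * c + c * M), by positivity, fun x hx D du u m m' hm hm' hdu hu => ?_⟩
  have hs : Real.sqrt (g x).det ≤ M := by
    have h1 := (le_abs_self _).trans ((hM1 x hx).trans (le_abs_self _))
    have : 0 ≤ ∑ i, ∑ j, |M2 i j| := by positivity
    simp only [M]; linarith
  have hA : ∀ i j, |(g x)⁻¹ i j| ≤ M := by
    intro i j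
    have h1 := (hM2 i j x hx).trans (le_abs_self _)
    have h2 := Finset.single_le_sum (f := fun j => |M2 i j|) (fun _ _ => abs_nonneg _)
      (Finset.mem_univ j)
    have h3 := Finset.single_le_sum (f := fun i => ∑ j, |M2 i j|)
      (fun _ _ => Finset.sum_nonneg fun _ _ => abs_nonneg _) (Finset.mem_univ i)
    have h4 : |M2 i j| ≤ ∑ j, |M2 i j| := h2
    have h5 : ∑ j, |M2 i j| ≤ ∑ i, ∑ j, |M2 i j| := h3
    have := abs_nonneg M1
    rw [Real.norm_eq_abs] at h1
    simp only [M]; linarith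
  have hN := aG_nonneg D
  obtain ⟨h1, h2, h3⟩ := hb (g x) D (aG D) hN hA hs (le_aG D)
  refine (aI_bound (g x) D du u c (aG D) M m m' hN hc h1 h2 h3 hs hdu hu).trans ?_
  have e1 : 0 ≤ n * c * M * m * aG D ^ 2 := by positivity
  have e2 : 0 ≤ (n * c * c + c * M) * m' * aG D := by positivity
  linarith

lemma measurable_aI (hcont : ∀ i j, Continuous fun x => g x i j)
    (hpos : ∀ x, (g x).PosDef) (hDgmeas : ∀ k i j, Measurable fun x => Dg x k i j)
    (du : EuclideanSpace ℝ (Fin n) → Fin n → ℝ) (u : EuclideanSpace ℝ (Fin n) → ℝ)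
    (hdu : ∀ k, Measurable fun x => du x k) (hu : Measurable u) :
    Measurable fun x => aI (g x) (Dg x) (du x) (u x) := by
  have h1 : ∀ i j, Measurable fun x => (g x)⁻¹ i j := fun i j =>
    (continuous_matinv hcont hpos i j).measurable
  have h2 : Measurable fun x => Real.sqrt (g x).det := (continuous_sqrtdet hcont).measurable
  have hS : ∀ f : Fin n → EuclideanSpace ℝ (Fin n) → ℝ, (∀ i, Measurable (f i)) →
      Measurable fun x => ∑ i, f i x := fun f hf => Finset.measurable_fun_sum _ fun i _ => hf i
  have hP : ∀ k i j, Measurable fun x => aPsi (g x) (Dg x) k i j := fun k i j =>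
    (hS _ fun l => (h1 k l).mul (((hDgmeas i j l).add (hDgmeas j i l)).sub
      (hDgmeas l i j))).const_mul _
  have hDi : ∀ k i j, Measurable fun x => aDinv (g x) (Dg x) k i j := fun k i j =>
    (hS _ fun q => hS _ fun s => ((h1 i q).mul (h1 j s)).mul (hDgmeas k q s)).neg
  have hV : ∀ k, Measurable fun x => aV (g x) (Dg x) k := fun k =>
    (hS _ fun i => hS _ fun j => (h1 i j).mul (hP k i j)).sub
      (hS _ fun i => hS _ fun j => (h1 i k).mul (hP j j i))
  have hT : ∀ k, Measurable fun x => aT (g x) (Dg x) k := fun k =>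
    (h2.const_mul _).mul (hS _ fun i => hS _ fun j => (h1 i j).mul (hDgmeas k i j))
  have hF : Measurable fun x => aF (g x) (Dg x) :=
    ((hS _ fun k => hS _ fun i => hS _ fun j => (hDi k i j).mul (hP k i j)).neg.add
      (hS _ fun k => hS _ fun i => (hDi k i k).mul (hS _ fun j => hP j j i))).add
      (hS _ fun i => hS _ fun j => (h1 i j).mul (hS _ fun k => hS _ fun l =>
        ((hP k k l).mul (hP l i j)).sub ((hP k j l).mul (hP l i k))))
  exact (hS _ fun k => (hV k).mul (((hdu k).mul h2).add (hu.mul (hT k)))).neg.add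
    ((hF.mul hu).mul h2)

lemma pd_zero_off (k : Fin n) (w : EuclideanSpace ℝ (Fin n) → ℝ) (x) (hx : x ∉ tsupport w) :
    pd k w x = 0 := by
  have : w =ᶠ[nhds x] fun _ => 0 := notMem_tsupport_iff_eventuallyEq.mp hx
  rw [pd_congr' k this]; simp [pd]

lemma pd_bound {w : EuclideanSpace ℝ (Fin n) → ℝ}
    (hw : ContDiff ℝ (⊤ : ℕ∞) w) (hwc : HasCompactSupport w) :
    ∃ m : ℝ, 0 ≤ m ∧ (∀ x k, |pd k w x| ≤ m) ∧ ∀ x, |w x| ≤ m := by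
  obtain ⟨m1, h1⟩ := hwc.exists_bound_of_continuous hw.continuous
  obtain ⟨m2, h2⟩ := (hwc.fderiv (𝕜 := ℝ)).exists_bound_of_continuous (hw.continuous_fderiv (by simp))
  refine ⟨max m1 m2, ((norm_nonneg _).trans (h1 0)).trans (le_max_left _ _), fun x k => ?_,
    fun x => (h1 x).trans (le_max_left _ _)⟩
  have := (fderiv ℝ w x).le_opNorm (EuclideanSpace.single k 1)
  rw [PiLp.norm_single, norm_one, mul_one] at this
  exact this.trans ((h2 x).trans (le_max_right _ _))

lemma continuous_pd {w : EuclideanSpace ℝ (Fin n) → ℝ}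
    (hw : ContDiff ℝ (⊤ : ℕ∞) w) (k : Fin n) : Continuous (pd k w) :=
  (hw.continuous_fderiv (by simp)).clm_apply continuous_const

lemma integrable_aI (hcont : ∀ i j, Continuous fun x => g x i j)
    (hpos : ∀ x, (g x).PosDef) (hDgmeas : ∀ k i j, Measurable fun x => Dg x k i j)
    (hDgL2 : ∀ (k i j : Fin n) (x₀ : EuclideanSpace ℝ (Fin n)) (R : ℝ),
      (∫⁻ x in Metric.ball x₀ R, ENNReal.ofReal ((Dg x k i j) ^ 2)) < ⊤)
    {w : EuclideanSpace ℝ (Fin n) → ℝ}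
    (hw : ContDiff ℝ (⊤ : ℕ∞) w) (hwc : HasCompactSupport w) :
    Integrable fun x => aI (g x) (Dg x) (fun k => pd k w x) (w x) := by
  obtain ⟨c, hc, hb⟩ := aux_pt hcont hpos (tsupport w) hwc
  obtain ⟨m, hm, hm1, hm2⟩ := pd_bound hw hwc
  have hK : MeasurableSet (tsupport w) := (isClosed_tsupport w).measurableSet
  have hG2 := aG_sq_integrableOn hDgmeas hDgL2 (tsupport w) hwc
  have hone : IntegrableOn (fun _ => (1 : ℝ)) (tsupport w) := by
    rw [integrableOn_const_iff]; right; exact hwc.measure_lt_top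
  have hint : Integrable ((tsupport w).indicator
      (fun x => c * m * 2 * (1 + aG (Dg x) ^ 2))) := by
    rw [integrable_indicator_iff hK]
    exact (hone.add hG2).const_mul _
  refine hint.mono' (measurable_aI hcont hpos hDgmeas _ _
    (fun k => (continuous_pd hw k).measurable) hw.continuous.measurable).aestronglyMeasurable
    (.of_forall fun x => ?_)
  by_cases hx : x ∈ tsupport w
  · rw [Set.indicator_of_mem hx]
    refine (hb x hx (Dg x) _ _ m m hm hm (hm1 x) (hm2 x)).trans ?_
    have : 0 ≤ c * m := mul_nonneg hc hm
    nlinarith [sq_nonneg (aG (Dg x) - 1)]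
  · rw [Set.indicator_of_notMem hx]
    simp [pd_zero_off _ w x hx, image_eq_zero_of_notMem_tsupport hx, aI]

end final

section final2
variable {n : ℕ} {g : EuclideanSpace ℝ (Fin n) → Matrix (Fin n) (Fin n) ℝ}
  {Dg : EuclideanSpace ℝ (Fin n) → Fin n → Fin n → Fin n → ℝ}

lemma aux_Dg_ae (hcont : ∀ i j, Continuous fun x => g x i j)
    (hDgmeas : ∀ k i j, Measurable fun x => Dg x k i j)
    (hDgL2 : ∀ (k i j : Fin n) (x₀ : EuclideanSpace ℝ (Fin n)) (R : ℝ),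
      (∫⁻ x in Metric.ball x₀ R, ENNReal.ofReal ((Dg x k i j) ^ 2)) < ⊤)
    (hweak : ∀ (k i j : Fin n) (φ : EuclideanSpace ℝ (Fin n) → ℝ),
      ContDiff ℝ (⊤ : ℕ∞) φ → HasCompactSupport φ →
      (∫ x, g x i j * pd k φ x) = -∫ x, Dg x k i j * φ x)
    (S : Set (EuclideanSpace ℝ (Fin n))) (hS : IsClosed S)
    (hsm : ∀ i j, ContDiffOn ℝ (⊤ : ℕ∞) (fun x => g x i j) Sᶜ) :
    ∀ᵐ x, x ∉ S → Dg x = fun k i j => pd k (fun z => g z i j) x := by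
  have h : ∀ k i j, ∀ᵐ x, x ∈ Sᶜ → Dg x k i j = pd k (fun z => g z i j) x := fun k i j =>
    aux_weak k (fun z => g z i j) (fun x => Dg x k i j) Sᶜ hS.isOpen_compl (hcont i j) (hsm i j)
      (aux_locInt _ (hDgmeas k i j) (hDgL2 k i j)) (hweak k i j)
  have h' := ae_all_iff.mpr fun k => ae_all_iff.mpr fun i => ae_all_iff.mpr fun j => h k i j
  filter_upwards [h'] with x hx hxS
  funext k i j
  exact hx k i j hxS

lemma aI_zero (A : Matrix (Fin n) (Fin n) ℝ) (D : Fin n → Fin n → Fin n → ℝ) :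
    aI A D (fun _ => 0) 0 = 0 := by
  simp [aI]

lemma aI_zero_D (A : Matrix (Fin n) (Fin n) ℝ) (D : Fin n → Fin n → Fin n → ℝ)
    (hD : ∀ k i j, D k i j = 0) (du : Fin n → ℝ) (u : ℝ) :
    aI A D du u = 0 := by
  simp [aI, aV, aF, aPsi, aDinv, hD]

lemma aux_flat_case (hn : 3 ≤ n) (a : ℝ)
    (S : Set (EuclideanSpace ℝ (Fin n))) (hScpt : IsCompact S)
    (hsm : ∀ i j, ContDiffOn ℝ (⊤ : ℕ∞) (fun x => g x i j) Sᶜ)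
    (hscal : ∀ x ∉ S, a ≤ scalarCurv g x)
    (hDg : ∀ᵐ x, x ∉ S → Dg x = fun k i j => pd k (fun z => g z i j) x)
    (hG : ∀ᵐ x, aG (Dg x) = 0)
    (u : EuclideanSpace ℝ (Fin n) → ℝ) (hu0 : ∀ x, 0 ≤ u x) :
    a * (∫ x, u x * Real.sqrt (g x).det) ≤
      ∫ x, aI (g x) (Dg x) (fun k => pd k u x) (u x) := by
  have hR : ∫ x, aI (g x) (Dg x) (fun k => pd k u x) (u x) = 0 := by
    rw [← integral_zero (EuclideanSpace ℝ (Fin n)) ℝ]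
    refine integral_congr_ae ?_
    filter_upwards [hG] with x hx
    refine aI_zero_D _ _ (fun k i j => ?_) _ _
    have := le_aG (Dg x) k i j
    rw [hx] at this
    exact abs_nonpos_iff.mp this
  rw [hR]
  have hO : IsOpen Sᶜ := hScpt.isClosed.isOpen_compl
  have hpd : ∀ k i j, ∀ x ∈ Sᶜ, pd k (fun z => g z i j) x = 0 := by
    intro k i j
    have hpc : ContinuousOn (pd k (fun z => g z i j)) Sᶜ := by
      intro x hx
      exact (contDiffAt_pd k
        ((hsm i j).contDiffAt (hO.mem_nhds hx))).continuousAt.continuousWithinAt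
    have hae : pd k (fun z => g z i j) =ᵐ[volume.restrict Sᶜ] fun _ => 0 := by
      rw [Filter.EventuallyEq, ae_restrict_iff' hO.measurableSet]
      filter_upwards [hDg, hG] with x h1 h2 hx
      have := le_aG (Dg x) k i j
      rw [h2, h1 hx] at this
      exact abs_nonpos_iff.mp this
    exact Measure.eqOn_open_of_ae_eq hae hO hpc continuousOn_const
  have hch : ∀ k i j, ∀ x ∈ Sᶜ, christoffel g x k i j = 0 := by
    intro k i j x hx
    simp [christoffel, hpd _ _ _ x hx]
  haveI : Nonempty (Fin n) := ⟨⟨0, by omega⟩⟩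
  haveI : Nontrivial (EuclideanSpace ℝ (Fin n)) := inferInstance
  haveI : NoncompactSpace (EuclideanSpace ℝ (Fin n)) := NormedSpace.noncompactSpace ℝ _
  obtain ⟨x, hx⟩ : ∃ x, x ∉ S := by
    by_contra hcon
    push Not at hcon
    exact noncompact_univ (EuclideanSpace ℝ (Fin n)) ((Set.eq_univ_of_forall hcon) ▸ hScpt)
  have hz : ∀ m k i j, pd m (fun z => christoffel g z k i j) x = 0 := by
    intro m k i j
    have : (fun z => christoffel g z k i j) =ᶠ[nhds x] fun _ => 0 := by
      filter_upwards [hO.mem_nhds hx] with z hz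
      exact hch k i j z hz
    rw [pd_congr' m this]; simp [pd]
  have ha : a ≤ 0 := by
    have := hscal x hx
    simpa [scalarCurv, hz, hch _ _ _ x hx] using this
  exact mul_nonpos_of_nonpos_of_nonneg ha
    (integral_nonneg fun x => mul_nonneg (hu0 x) (Real.sqrt_nonneg _))

lemma aux_step (a : ℝ) (hcont : ∀ i j, Continuous fun x => g x i j)
    (hpos : ∀ x, (g x).PosDef)
    (hDgmeas : ∀ k i j, Measurable fun x => Dg x k i j)
    (hDgL2 : ∀ (k i j : Fin n) (x₀ : EuclideanSpace ℝ (Fin n)) (R : ℝ),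
      (∫⁻ x in Metric.ball x₀ R, ENNReal.ofReal ((Dg x k i j) ^ 2)) < ⊤)
    (S : Set (EuclideanSpace ℝ (Fin n))) (hS : IsClosed S)
    (hsm : ∀ i j, ContDiffOn ℝ (⊤ : ℕ∞) (fun x => g x i j) Sᶜ)
    (hscal : ∀ x ∉ S, a ≤ scalarCurv g x)
    (hDg : ∀ᵐ x, x ∉ S → Dg x = fun k i j => pd k (fun z => g z i j) x)
    (u : EuclideanSpace ℝ (Fin n) → ℝ) (hu : ContDiff ℝ (⊤ : ℕ∞) u) (huc : HasCompactSupport u)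
    (hu0 : ∀ x, 0 ≤ u x) (c m : ℝ) (hc : 0 ≤ c) (hm : 0 ≤ m)
    (hpt : ∀ x ∈ tsupport u, ∀ (D : Fin n → Fin n → Fin n → ℝ) (du : Fin n → ℝ) (v m m' : ℝ),
      0 ≤ m → 0 ≤ m' → (∀ k, |du k| ≤ m') → |v| ≤ m →
      |aI (g x) D du v| ≤ c * (m' * aG D + m * aG D ^ 2))
    (hm1 : ∀ x k, |pd k u x| ≤ m) (hm2 : ∀ x, |u x| ≤ m)
    (ε E : ℝ) (hε : 0 < ε) (hε1 : ε ≤ 1) (hE : 0 ≤ E)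
    (hdec : ∫⁻ x in thickening (4 * ε) S, ENNReal.ofReal (ε⁻¹ * aG (Dg x)) ≤ ENNReal.ofReal E) :
    a * (∫ x, u x * Real.sqrt (g x).det) ≤
      (∫ x, aI (g x) (Dg x) (fun k => pd k u x) (u x)) +
      (|a| * (∫ x in thickening (4 * ε) S, u x * Real.sqrt (g x).det) +
       c * (2 * m * E + m * ∫ x in thickening (4 * ε) S,
          (tsupport u).indicator (fun x => aG (Dg x) ^ 2) x)) := by
  obtain ⟨χ, hχ, hχ0, hχ1, hχS, hχT, hχd, hχdT⟩ := aux_cutoff S ε hε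
  set T := thickening (4 * ε) S with hTdef
  have hTm : MeasurableSet T := isOpen_thickening.measurableSet
  set w : EuclideanSpace ℝ (Fin n) → ℝ := fun x => u x * (1 - χ x) with hwdef
  set v : EuclideanSpace ℝ (Fin n) → ℝ := fun x => u x * χ x with hvdef
  have hw : ContDiff ℝ (⊤ : ℕ∞) w := hu.mul (contDiff_const.sub hχ)
  have hv : ContDiff ℝ (⊤ : ℕ∞) v := hu.mul hχ
  have hwc : HasCompactSupport w := huc.mul_right
  have hvc : HasCompactSupport v := huc.mul_right
  have hIw := integrable_aI hcont hpos hDgmeas hDgL2 hw hwc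
  have hIv := integrable_aI hcont hpos hDgmeas hDgL2 hv hvc
  have huv : ∀ x, u x = w x + v x := fun x => by simp only [hwdef, hvdef]; ring
  have hpduv : ∀ x k, pd k u x = pd k w x + pd k v x := by
    intro x k
    rw [← pd_add' k (hw.differentiable (by simp) x) (hv.differentiable (by simp) x)]
    congr 1
    funext z; exact huv z
  have hsplit : (∫ x, aI (g x) (Dg x) (fun k => pd k u x) (u x)) =
      (∫ x, aI (g x) (Dg x) (fun k => pd k w x) (w x)) +
      ∫ x, aI (g x) (Dg x) (fun k => pd k v x) (v x) := by
    rw [← integral_add hIw hIv]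
    congr 1
    funext x
    rw [← aI_add, ← huv x]
    congr 1
    funext k; exact hpduv x k
  have hmain := aux_main_ineq a g hcont hpos Dg S hS hsm hscal hDg w hw hwc
    (fun x => mul_nonneg (hu0 x) (by linarith [hχ1 x])) (thickening ε S) isOpen_thickening
    (self_subset_thickening hε S) (fun x hx => by simp [hwdef, hχS x hx]) hIw
  have hsd := continuous_sqrtdet hcont
  have hiu : Integrable fun x => u x * Real.sqrt (g x).det :=
    (hu.continuous.mul hsd).integrable_of_hasCompactSupport huc.mul_right
  have hiw : Integrable fun x => w x * Real.sqrt (g x).det :=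
    (hw.continuous.mul hsd).integrable_of_hasCompactSupport hwc.mul_right
  have hiv : Integrable fun x => v x * Real.sqrt (g x).det :=
    (hv.continuous.mul hsd).integrable_of_hasCompactSupport hvc.mul_right
  have hsplit2 : (∫ x, u x * Real.sqrt (g x).det) =
      (∫ x, w x * Real.sqrt (g x).det) + ∫ x, v x * Real.sqrt (g x).det := by
    rw [← integral_add hiw hiv]
    congr 1
    funext x
    rw [huv x]; ring
  have hv0 : 0 ≤ ∫ x, v x * Real.sqrt (g x).det :=
    integral_nonneg fun x => mul_nonneg (mul_nonneg (hu0 x) (hχ0 x)) (Real.sqrt_nonneg _)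
  have hvle : ∫ x, v x * Real.sqrt (g x).det ≤ ∫ x in T, u x * Real.sqrt (g x).det := by
    rw [← integral_indicator hTm]
    refine integral_mono hiv (hiu.indicator hTm) fun x => ?_
    by_cases hx : x ∈ T
    · rw [Set.indicator_of_mem hx]
      refine mul_le_mul_of_nonneg_right ?_ (Real.sqrt_nonneg _)
      exact mul_le_of_le_one_right (hu0 x) (hχ1 x)
    · rw [Set.indicator_of_notMem hx]
      simp [hvdef, hχT x hx]
  have hav : a * (∫ x, v x * Real.sqrt (g x).det) ≤
      |a| * ∫ x in T, u x * Real.sqrt (g x).det :=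
    (mul_le_mul_of_nonneg_right (le_abs_self a) hv0).trans
      (mul_le_mul_of_nonneg_left hvle (abs_nonneg a))
  -- the error term
  have hGm := measurable_aG hDgmeas
  have hεi : 1 ≤ ε⁻¹ := (one_le_inv₀ hε).mpr hε1
  have hGi : IntegrableOn (fun x => ε⁻¹ * aG (Dg x)) T := by
    refine ⟨(hGm.const_mul _).aestronglyMeasurable, ?_⟩
    rw [hasFiniteIntegral_iff_ofReal
      (.of_forall fun x => mul_nonneg (by positivity) (aG_nonneg _))]
    exact hdec.trans_lt ENNReal.ofReal_lt_top
  have hGle : ∫ x in T, ε⁻¹ * aG (Dg x) ≤ E := by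
    rw [integral_eq_lintegral_of_nonneg_ae
      (.of_forall fun x => mul_nonneg (by positivity) (aG_nonneg _))
      (hGm.const_mul _).aestronglyMeasurable]
    exact ENNReal.toReal_le_of_le_ofReal hE hdec
  have hKm : MeasurableSet (tsupport u) := (isClosed_tsupport u).measurableSet
  have hG2 : Integrable ((tsupport u).indicator (fun x => aG (Dg x) ^ 2)) := by
    rw [integrable_indicator_iff hKm]
    exact aG_sq_integrableOn hDgmeas hDgL2 (tsupport u) huc
  have hdom : IntegrableOn (fun x => c * (2 * m * (ε⁻¹ * aG (Dg x)) +
      m * (tsupport u).indicator (fun x => aG (Dg x) ^ 2) x)) T :=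
    ((hGi.const_mul _).add (hG2.integrableOn.const_mul _)).const_mul _
  have hpw : ∀ x, ‖aI (g x) (Dg x) (fun k => pd k v x) (v x)‖ ≤
      T.indicator (fun x => c * (2 * m * (ε⁻¹ * aG (Dg x)) +
      m * (tsupport u).indicator (fun x => aG (Dg x) ^ 2) x)) x := by
    intro x
    have hpdv : ∀ k, pd k v x = pd k u x * χ x + u x * pd k χ x := fun k =>
      pd_mul' k (hu.differentiable (by simp) x) (hχ.differentiable (by simp) x)
    by_cases hx : x ∈ T
    · rw [Set.indicator_of_mem hx]
      by_cases hxK : x ∈ tsupport u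
      · rw [Set.indicator_of_mem hxK, Real.norm_eq_abs]
        refine (hpt x hxK (Dg x) _ _ m (2 * m * ε⁻¹) hm (by positivity) (fun k => ?_) ?_).trans
          (le_of_eq (by ring))
        · rw [hpdv k]
          have hχk : |pd k χ x| ≤ ε⁻¹ := by
            have := (fderiv ℝ χ x).le_opNorm (EuclideanSpace.single k 1)
            rw [PiLp.norm_single, norm_one, mul_one] at this
            exact this.trans (hχd x)
          have h1 : |χ x| ≤ 1 := abs_le.mpr ⟨by linarith [hχ0 x], hχ1 x⟩
          have h2 := abs_mul_le' (hm1 x k) h1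
          have h3 := abs_mul_le' (hm2 x) hχk
          have h4 : m * 1 ≤ m * ε⁻¹ := mul_le_mul_of_nonneg_left hεi hm
          refine (abs_add_le _ _).trans ?_
          linarith
        · have h1 : |χ x| ≤ 1 := abs_le.mpr ⟨by linarith [hχ0 x], hχ1 x⟩
          have h2 := abs_mul_le' (hm2 x) h1
          simpa [hvdef] using h2
      · have h0 : aI (g x) (Dg x) (fun k => pd k v x) (v x) = 0 := by
          have e1 : v x = 0 := by simp [hvdef, image_eq_zero_of_notMem_tsupport hxK]
          have e2 : (fun k => pd k v x) = fun _ => 0 := by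
            funext k
            rw [hpdv k, pd_zero_off k u x hxK, image_eq_zero_of_notMem_tsupport hxK]; ring
          rw [e1, e2, aI_zero]
        rw [h0, norm_zero, Set.indicator_of_notMem hxK]
        have := aG_nonneg (Dg x)
        positivity
    · rw [Set.indicator_of_notMem hx]
      have h0 : aI (g x) (Dg x) (fun k => pd k v x) (v x) = 0 := by
        have e1 : v x = 0 := by simp [hvdef, hχT x hx]
        have e2 : (fun k => pd k v x) = fun _ => 0 := by
          funext k
          have : pd k χ x = 0 := by simp [pd, hχdT x hx]
          rw [hpdv k, hχT x hx, this]; ring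
        rw [e1, e2, aI_zero]
      rw [h0, norm_zero]
  have herr : ‖∫ x, aI (g x) (Dg x) (fun k => pd k v x) (v x)‖ ≤
      c * (2 * m * E + m * ∫ x in T, (tsupport u).indicator (fun x => aG (Dg x) ^ 2) x) := by
    refine (norm_integral_le_of_norm_le ((integrable_indicator_iff hTm).mpr hdom)
      (.of_forall hpw)).trans ?_
    rw [integral_indicator hTm, integral_const_mul,
      integral_add (hGi.const_mul _) (hG2.integrableOn.const_mul _),
      integral_const_mul, integral_const_mul, integral_const_mul]
    rw [integral_const_mul] at hGle
    exact mul_le_mul_of_nonneg_left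
      (add_le_add (mul_le_mul_of_nonneg_left hGle (by positivity)) le_rfl) hc
  have herr' := (abs_le.mp herr).1
  rw [hsplit, hsplit2, mul_add]
  linarith

lemma aux_limit_case (a p δ δ' r₀ L : ℝ) (hp : 2 ≤ p) (hδ'δ : δ' < δ) (hδp : δ ≤ p)
    (hr₀ : 0 < r₀) (hL : 0 < L)
    (hcont : ∀ i j, Continuous fun x => g x i j)
    (hpos : ∀ x, (g x).PosDef)
    (hDgmeas : ∀ k i j, Measurable fun x => Dg x k i j)
    (hDgL2 : ∀ (k i j : Fin n) (x₀ : EuclideanSpace ℝ (Fin n)) (R : ℝ),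
      (∫⁻ x in Metric.ball x₀ R, ENNReal.ofReal ((Dg x k i j) ^ 2)) < ⊤)
    (hMorrey : ∀ (x₀ : EuclideanSpace ℝ (Fin n)) (r : ℝ), 0 < r → r < r₀ →
      (∫⁻ x in Metric.ball x₀ r, ENNReal.ofReal ((aG (Dg x)) ^ p)) ≤
        ENNReal.ofReal (L * r ^ ((n : ℝ) - p + δ)))
    (S : Set (EuclideanSpace ℝ (Fin n))) (hS : IsClosed S) (C b : ℝ)
    (hC : 0 < C) (hb : 0 < b)
    (hvol : ∀ ε : ℝ, 0 < ε → ε ≤ b →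
      volume (Metric.thickening ε S) ≤ ENNReal.ofReal (C * ε ^ (2 - δ'/p)))
    (hsm : ∀ i j, ContDiffOn ℝ (⊤ : ℕ∞) (fun x => g x i j) Sᶜ)
    (hscal : ∀ x ∉ S, a ≤ scalarCurv g x)
    (hDg : ∀ᵐ x, x ∉ S → Dg x = fun k i j => pd k (fun z => g z i j) x)
    (u : EuclideanSpace ℝ (Fin n) → ℝ) (hu : ContDiff ℝ (⊤ : ℕ∞) u) (huc : HasCompactSupport u)
    (hu0 : ∀ x, 0 ≤ u x) :
    a * (∫ x, u x * Real.sqrt (g x).det) ≤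
      ∫ x, aI (g x) (Dg x) (fun k => pd k u x) (u x) := by
  obtain ⟨c, hc, hpt⟩ := aux_pt hcont hpos (tsupport u) huc
  obtain ⟨m, hm, hm1, hm2⟩ := pd_bound hu huc
  obtain ⟨c₁, e, ε₀, hc₁, he, hε₀, hdec⟩ := aux_decay p δ δ' r₀ L hp hδ'δ hr₀ hL
    (fun x => aG (Dg x)) (measurable_aG hDgmeas) (fun x => aG_nonneg _) hMorrey S C b hC hb hvol
  have hq : 0 < 2 - δ' / p := by
    have hp0 : 0 < p := by linarith
    have : δ' / p < 1 := (div_lt_one hp0).mpr (by linarith)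
    linarith
  have hpow : ∀ (q A : ℝ), 0 < q → Filter.Tendsto (fun ε : ℝ => A * ε ^ q)
      (nhdsWithin 0 (Set.Ioi 0)) (nhds 0) := by
    intro q A hq
    have h1 : Filter.Tendsto (fun ε : ℝ => A * ε ^ q) (nhds 0) (nhds (A * 0 ^ q)) :=
      ((Real.continuousAt_rpow_const 0 q (Or.inr hq.le)).tendsto).const_mul A
    rw [Real.zero_rpow hq.ne', mul_zero] at h1
    exact h1.mono_left nhdsWithin_le_nhds
  have hvolT : Filter.Tendsto (fun ε : ℝ => volume (thickening (4 * ε) S))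
      (nhdsWithin 0 (Set.Ioi 0)) (nhds 0) := by
    have h4 : Filter.Tendsto (fun ε : ℝ => 4 * ε) (nhdsWithin 0 (Set.Ioi 0))
        (nhdsWithin 0 (Set.Ioi 0)) := by
      refine tendsto_nhdsWithin_iff.mpr ⟨?_, ?_⟩
      · have : Filter.Tendsto (fun ε : ℝ => 4 * ε) (nhds 0) (nhds (4 * 0)) :=
          (continuous_const.mul continuous_id).tendsto 0
        rw [mul_zero] at this
        exact this.mono_left nhdsWithin_le_nhds
      · filter_upwards [self_mem_nhdsWithin] with ε hε
        have : (0 : ℝ) < ε := hε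
        exact Set.mem_Ioi.mpr (by linarith)
    have h1 := ENNReal.tendsto_ofReal ((hpow _ C hq).comp h4)
    rw [ENNReal.ofReal_zero] at h1
    refine tendsto_of_tendsto_of_tendsto_of_le_of_le' tendsto_const_nhds h1
      (.of_forall fun _ => zero_le) ?_
    filter_upwards [Ioo_mem_nhdsGT (show (0 : ℝ) < b / 4 by positivity)] with ε hε
    exact hvol (4 * ε) (by linarith [hε.1]) (by linarith [hε.2])
  have hsd := continuous_sqrtdet hcont
  have hiu : Integrable fun x => u x * Real.sqrt (g x).det :=
    (hu.continuous.mul hsd).integrable_of_hasCompactSupport huc.mul_right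
  have hG2 : Integrable ((tsupport u).indicator (fun x => aG (Dg x) ^ 2)) := by
    rw [integrable_indicator_iff (isClosed_tsupport u).measurableSet]
    exact aG_sq_integrableOn hDgmeas hDgL2 (tsupport u) huc
  have hlim1 := hiu.tendsto_setIntegral_nhds_zero hvolT
  have hlim2 := hG2.tendsto_setIntegral_nhds_zero hvolT
  have hlim : Filter.Tendsto (fun ε : ℝ =>
      (∫ x, aI (g x) (Dg x) (fun k => pd k u x) (u x)) +
      (|a| * (∫ x in thickening (4 * ε) S, u x * Real.sqrt (g x).det) +
       c * (2 * m * (c₁ * ε ^ e) + m * ∫ x in thickening (4 * ε) S,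
          (tsupport u).indicator (fun x => aG (Dg x) ^ 2) x)))
      (nhdsWithin 0 (Set.Ioi 0))
      (nhds ((∫ x, aI (g x) (Dg x) (fun k => pd k u x) (u x)) +
        (|a| * 0 + c * (2 * m * 0 + m * 0)))) :=
    tendsto_const_nhds.add ((hlim1.const_mul _).add
      ((((hpow e c₁ he).const_mul _).add (hlim2.const_mul _)).const_mul _))
  simp only [mul_zero, add_zero] at hlim
  refine ge_of_tendsto hlim ?_
  filter_upwards [Ioo_mem_nhdsGT hε₀, Ioo_mem_nhdsGT (zero_lt_one' ℝ)] with ε h1 h2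
  exact aux_step a hcont hpos hDgmeas hDgL2 S hS hsm hscal hDg u hu huc hu0 c m hc hm hpt hm1 hm2
    ε (c₁ * ε ^ e) h1.1 h2.2.le (mul_nonneg hc₁.le (Real.rpow_nonneg h1.1.le _))
    (hdec ε h1.1 h1.2)

end final2


/-- Euclidean-background case of Proposition 4.2 of the paper: under the L^∞ and
Morrey-type conditions, a classical scalar curvature lower bound outside a compact
singular set of co-dimension at least 2 − δ′/p extends to a distributional scalar
curvature lower bound across the singular set. -/
theorem stmt19 (n : ℕ) (hn : 3 ≤ n) (Λ p δ δ' r₀ L a : ℝ)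
    (hΛ : 1 < Λ) (hp : 2 ≤ p) (hδ' : 0 < δ') (hδ'δ : δ' < δ)
    (hr₀ : 0 < r₀) (hL : 0 < L)
    (g : EuclideanSpace ℝ (Fin n) → Matrix (Fin n) (Fin n) ℝ)
    (hcont : ∀ i j, Continuous fun x => g x i j)
    (hpos : ∀ x, (g x).PosDef)
    (hsandwich : ∀ x,
      (g x - Λ⁻¹ • (1 : Matrix (Fin n) (Fin n) ℝ)).PosSemidef ∧
      (Λ • (1 : Matrix (Fin n) (Fin n) ℝ) - g x).PosSemidef)
    -- the weak (W^{1,2}_loc) gradient of g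
    (Dg : EuclideanSpace ℝ (Fin n) → Fin n → Fin n → Fin n → ℝ)
    (hDgmeas : ∀ k i j, Measurable fun x => Dg x k i j)
    (hDgL2 : ∀ (k i j : Fin n) (x₀ : EuclideanSpace ℝ (Fin n)) (R : ℝ),
      (∫⁻ x in Metric.ball x₀ R, ENNReal.ofReal ((Dg x k i j) ^ 2)) < ⊤)
    (hweak : ∀ (k i j : Fin n) (φ : EuclideanSpace ℝ (Fin n) → ℝ),
      ContDiff ℝ (⊤ : ℕ∞) φ → HasCompactSupport φ →
      (∫ x, g x i j * pd k φ x) = -∫ x, Dg x k i j * φ x)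
    -- (ii) the Morrey-type condition on |∇g|
    (hMorrey : ∀ (x₀ : EuclideanSpace ℝ (Fin n)) (r : ℝ), 0 < r → r < r₀ →
      (∫⁻ x in Metric.ball x₀ r,
          ENNReal.ofReal ((Real.sqrt (∑ k, ∑ i, ∑ j, (Dg x k i j) ^ 2)) ^ p)) ≤
        ENNReal.ofReal (L * r ^ ((n : ℝ) - p + δ)))
    -- (iii) the compact singular set of co-dimension at least 2 − δ'/p
    (S : Set (EuclideanSpace ℝ (Fin n))) (hScpt : IsCompact S) (C b : ℝ)
    (hC : 0 < C) (hb : 0 < b)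
    (hvol : ∀ ε : ℝ, 0 < ε → ε ≤ b →
      volume (Metric.thickening ε S) ≤ ENNReal.ofReal (C * ε ^ (2 - δ'/p)))
    (hsm : ∀ i j, ContDiffOn ℝ (⊤ : ℕ∞) (fun x => g x i j) Sᶜ)
    (hscal : ∀ x ∉ S, a ≤ scalarCurv g x) :
    -- conclusion: distributional scalar curvature lower bound
    ∀ u : EuclideanSpace ℝ (Fin n) → ℝ,
      ContDiff ℝ (⊤ : ℕ∞) u → HasCompactSupport u → (∀ x, 0 ≤ u x) →
      let Ψ : EuclideanSpace ℝ (Fin n) → Fin n → Fin n → Fin n → ℝ := fun x k i j =>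
        (1/2) * ∑ l, (g x)⁻¹ k l * (Dg x i j l + Dg x j i l - Dg x l i j);
      let Dginv : EuclideanSpace ℝ (Fin n) → Fin n → Fin n → Fin n → ℝ := fun x k i j =>
        -∑ q, ∑ s, (g x)⁻¹ i q * (g x)⁻¹ j s * Dg x k q s;
      let V : EuclideanSpace ℝ (Fin n) → Fin n → ℝ := fun x k =>
        (∑ i, ∑ j, (g x)⁻¹ i j * Ψ x k i j) - ∑ i, ∑ j, (g x)⁻¹ i k * Ψ x j j i;
      let F : EuclideanSpace ℝ (Fin n) → ℝ := fun x =>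
        -(∑ k, ∑ i, ∑ j, Dginv x k i j * Ψ x k i j)
          + (∑ k, ∑ i, Dginv x k i k * ∑ j, Ψ x j j i)
          + ∑ i, ∑ j, (g x)⁻¹ i j *
              ∑ k, ∑ l, (Ψ x k k l * Ψ x l i j - Ψ x k j l * Ψ x l i k);
      -- the weak gradient of u √(det g)
      let Dusqrt : EuclideanSpace ℝ (Fin n) → Fin n → ℝ := fun x k =>
        pd k u x * Real.sqrt (g x).det +
          u x * ((1/2) * Real.sqrt (g x).det * ∑ i, ∑ j, (g x)⁻¹ i j * Dg x k i j);
      a * (∫ x, u x * Real.sqrt (g x).det) ≤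
        ∫ x, (-(∑ k, V x k * Dusqrt x k) + F x * u x * Real.sqrt (g x).det) := by
  intro u hu huc hu0
  have hDg := aux_Dg_ae hcont hDgmeas hDgL2 hweak S hScpt.isClosed hsm
  rcases lt_or_ge p δ with hpδ | hpδ
  · exact aux_flat_case hn a S hScpt hsm hscal hDg
      (aux_zero p δ r₀ L hp hpδ hr₀ hL (fun x => aG (Dg x)) (measurable_aG hDgmeas)
        (fun x => aG_nonneg _) hMorrey) u hu0
  · exact aux_limit_case a p δ δ' r₀ L hp hδ'δ hpδ hr₀ hL hcont hpos hDgmeas hDgL2 hMorrey S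
      hScpt.isClosed C b hC hb hvol hsm hscal hDg u hu huc hu0
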